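/- arXiv:1208.2149 — 10 statements merged into one kernel-verified Lean document; each statement's English description precedes it below -/
import Mathlib

section
/- Let n be an odd positive squarefree integer and e a (possibly negative) squarefree divisor of 2n. Then the curve C_e : e·w² = e²t⁴ + 4n²z⁴ is S-locally solvable if and only if all of the following hold: (1) e > 0 and e has no prime factor ≡ 3 (mod 4); (2) (n/e / p) = 1 for every odd prime p dividing e; (3) (e / p) = 1 for every odd prime p dividing 2n/e; (4) if e is even, then n ≡ ±1 (mod 8). -/
noncomputable section

/-- The curve `C_e : e·w² = e²t⁴ + 4n²z⁴` is S-locally solvable: it has a real point and a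
`ℚ_p`-point with `(t,z) ≠ (0,0)` for every prime `p ∣ 2n`. -/
def SLocSolvC (n : ℕ) (e : ℤ) : Prop :=
  (∃ w t z : ℝ, (t, z) ≠ (0, 0) ∧
      (e : ℝ) * w ^ 2 = (e : ℝ) ^ 2 * t ^ 4 + 4 * (n : ℝ) ^ 2 * z ^ 4) ∧
  ∀ (p : ℕ) [Fact p.Prime], p ∣ 2 * n → ∃ w t z : ℚ_[p], (t, z) ≠ (0, 0) ∧
      (e : ℚ_[p]) * w ^ 2 = (e : ℚ_[p]) ^ 2 * t ^ 4 + 4 * (n : ℚ_[p]) ^ 2 * z ^ 4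

open Classical in
/-- For `p` odd and `x ∈ ℚ_p^×` of even valuation, the extended Legendre symbol `(x/p)`,
i.e. the Legendre symbol of the unit part of `x`: it equals `1` iff `x` is a square in `ℚ_p`,
and `-1` otherwise. -/
def padicSym (p : ℕ) [Fact p.Prime] (x : ℚ_[p]) : ℤ := if IsSquare x then 1 else -1

open Polynomial in
theorem Padic.isSquare_of_norm_sub_one_lt {p : ℕ} [Fact p.Prime] {x : ℚ_[p]}
    (hx : ‖x - 1‖ < ‖(2 : ℚ_[p])‖ ^ 2) : IsSquare x := by
  have h2 : ‖(2 : ℚ_[p])‖ ≤ 1 := by exact_mod_cast Padic.norm_int_le_one (p := p) 2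
  have hx1 : ‖x‖ ≤ 1 := by
    have h := Padic.nonarchimedean (x - 1) 1
    rw [sub_add_cancel, norm_one] at h
    exact h.trans (max_le (hx.le.trans (pow_le_one₀ (norm_nonneg _) h2)) le_rfl)
  obtain ⟨x, rfl⟩ : ∃ x' : ℤ_[p], (x' : ℚ_[p]) = x := ⟨⟨x, hx1⟩, rfl⟩
  obtain ⟨z, hz, -⟩ := hensels_lemma (p := p) (R := ℤ_[p]) (F := X ^ 2 - C x) (a := 1) (by
    have h1 : aeval (1 : ℤ_[p]) (X ^ 2 - C x) = 1 - x := by simp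
    have h2 : aeval (1 : ℤ_[p]) (derivative (X ^ 2 - C x)) = 2 := by simp [one_add_one_eq_two]
    rw [h1, h2, norm_sub_rev]
    exact hx)
  have hz' : z ^ 2 - x = 0 := by simpa using hz
  refine ⟨z, ?_⟩
  rw [← sub_eq_zero.mp hz', ← pow_two]
  push_cast
  rfl

theorem Padic.isSquare_of_norm_sub_sq_lt {p : ℕ} [Fact p.Prime] {x y : ℚ_[p]}
    (h : ‖x - y ^ 2‖ < ‖(2 : ℚ_[p])‖ ^ 2 * ‖y‖ ^ 2) : IsSquare x := by
  have hy : y ≠ 0 := by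
    rintro rfl
    simp only [norm_zero, ne_eq, OfNat.ofNat_ne_zero, not_false_eq_true, zero_pow, mul_zero] at h
    exact absurd h (norm_nonneg _).not_gt
  have h1 : IsSquare (x / y ^ 2) := by
    refine Padic.isSquare_of_norm_sub_one_lt ?_
    rw [div_sub_one (pow_ne_zero 2 hy), norm_div, norm_pow, div_lt_iff₀ (by positivity)]
    exact h
  simpa [hy] using h1.mul (IsSquare.sq y)

theorem Padic.norm_two_eq_one {p : ℕ} [Fact p.Prime] (hp : p ≠ 2) : ‖(2 : ℚ_[p])‖ = 1 := by
  have := (Padic.norm_natCast_eq_one_iff (p := p) (n := 2)).2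
    ((Nat.coprime_primes Fact.out Nat.prime_two).2 hp)
  exact_mod_cast this

theorem Padic.norm_intCast_eq_one_of_not_dvd {p : ℕ} [Fact p.Prime] {a : ℤ}
    (ha : ¬(p : ℤ) ∣ a) : ‖(a : ℚ_[p])‖ = 1 :=
  le_antisymm (Padic.norm_int_le_one a) (not_lt.1 fun h => ha (Padic.norm_intCast_lt_one_iff.1 h))

theorem Padic.isSquare_intCast_iff {p : ℕ} [Fact p.Prime] (hp : p ≠ 2) {a : ℤ}
    (ha : ¬(p : ℤ) ∣ a) : IsSquare (a : ℚ_[p]) ↔ IsSquare (a : ZMod p) := by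
  have ha1 := Padic.norm_intCast_eq_one_of_not_dvd ha
  constructor
  · rintro ⟨y, hy⟩
    have hy1 : ‖y‖ ≤ 1 := by
      rw [hy, norm_mul] at ha1
      nlinarith [norm_nonneg y]
    obtain ⟨y, rfl⟩ : ∃ y' : ℤ_[p], (y' : ℚ_[p]) = y := ⟨⟨y, hy1⟩, rfl⟩
    have h : (a : ℤ_[p]) = y * y := by
      apply Subtype.ext
      simpa using hy
    refine ⟨PadicInt.toZMod y, ?_⟩
    rw [← map_mul, ← h, map_intCast]
  · rintro ⟨b, hb⟩
    obtain ⟨c, rfl⟩ := ZMod.intCast_surjective b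
    have hd : (p : ℤ) ∣ a - c ^ 2 := by
      rw [← ZMod.intCast_zmod_eq_zero_iff_dvd]
      push_cast
      rw [hb]; ring
    have hc : ¬(p : ℤ) ∣ c := fun h => ha ((dvd_sub_left (dvd_pow h two_ne_zero)).1 hd)
    refine Padic.isSquare_of_norm_sub_sq_lt (y := c) ?_
    rw [Padic.norm_two_eq_one hp, Padic.norm_intCast_eq_one_of_not_dvd hc]
    have := Padic.norm_intCast_lt_one_iff.2 hd
    push_cast at this
    simpa using this

theorem Padic.norm_sq_ne_inv_mul_norm_sq {p : ℕ} [Fact p.Prime] {x y : ℚ_[p]} (hy : y ≠ 0) :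
    ‖x‖ ^ 2 ≠ (p : ℝ)⁻¹ * ‖y‖ ^ 2 := by
  intro h
  have hp : 1 < (p : ℝ) := by exact_mod_cast (Fact.out : p.Prime).one_lt
  have hx : x ≠ 0 := by
    rintro rfl
    have : 0 < (p : ℝ)⁻¹ * ‖y‖ ^ 2 := by positivity
    rw [← h] at this
    simp at this
  rw [Padic.norm_eq_zpow_neg_valuation hx, Padic.norm_eq_zpow_neg_valuation hy, ← zpow_natCast,
    ← zpow_natCast, ← zpow_mul, ← zpow_mul, ← zpow_neg_one, ← zpow_add₀ (by positivity),
    zpow_right_inj₀ (by positivity) hp.ne'] at h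
  push_cast at h
  omega

theorem Padic.isSquare_intCast_div {a b : ℤ} (hb : ¬(2 : ℤ) ∣ b) (h : (8 : ℤ) ∣ a - b) :
    IsSquare ((a : ℚ_[2]) / b) := by
  have hb1 := Padic.norm_intCast_eq_one_of_not_dvd (p := 2) hb
  have hb0 : (b : ℚ_[2]) ≠ 0 := norm_ne_zero_iff.1 (by rw [hb1]; exact one_ne_zero)
  refine Padic.isSquare_of_norm_sub_one_lt ?_
  have h2 : ‖(2 : ℚ_[2])‖ = 2⁻¹ := by exact_mod_cast Padic.norm_p (p := 2)
  have h3 := (Padic.norm_int_le_pow_iff_dvd (p := 2) (a - b) 3).2 (by exact_mod_cast h)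
  rw [div_sub_one hb0, norm_div, hb1, h2]
  push_cast at h3
  norm_num at h3 ⊢
  linarith

theorem Padic.norm_add_eq_left {p : ℕ} [Fact p.Prime] {x y : ℚ_[p]} (h : ‖y‖ < ‖x‖) :
    ‖x + y‖ = ‖x‖ := by
  rw [Padic.add_eq_max_of_ne h.ne', max_eq_left h.le]

theorem Padic.isSquare_of_mul_sq_eq_add {p : ℕ} [Fact p.Prime] (hp : p ≠ 2) {e w x y : ℚ_[p]}
    (h : e * w ^ 2 = x ^ 2 + y ^ 2) (hxy : ‖y‖ < ‖x‖) : IsSquare e := by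
  have h1 : IsSquare (e * w ^ 2) := by
    refine Padic.isSquare_of_norm_sub_sq_lt (y := x) ?_
    rw [h, Padic.norm_two_eq_one hp, add_sub_cancel_left, norm_pow, one_pow, one_mul]
    gcongr
  have hw : w ≠ 0 := by
    rintro rfl
    have := Padic.norm_add_eq_left (x := x ^ 2) (y := y ^ 2)
      (by simpa only [norm_pow] using by gcongr)
    rw [← h] at this
    have hx : 0 < ‖x‖ := (norm_nonneg y).trans_lt hxy
    simp at this
    exact hx.ne' (norm_eq_zero.2 (by simpa using this.symm))
  simpa [hw] using h1.div (IsSquare.sq w)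

theorem Nat.mod_four_eq_one_of_prime_dvd {m : ℕ} (hm : Odd m)
    (h : ∀ p : ℕ, p.Prime → p % 4 = 3 → ¬p ∣ m) : m % 4 = 1 := by
  induction m using induction_on_primes with
  | zero => simp at hm
  | one => rfl
  | prime_mul p a hp ih =>
    rw [Nat.odd_mul] at hm
    have h1 := ih hm.2 fun q hq hq3 hqa => h q hq hq3 (hqa.mul_left p)
    have h2 : p % 4 ≠ 3 := fun h3 => h p hp h3 (dvd_mul_right p a)
    have h3 := Nat.odd_iff.1 hm.1
    have h4 : p % 4 = 1 := by omega
    simp [Nat.mul_mod, h1, h4]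

theorem Padic.isSquare_of_sq_eq_mul_add {p : ℕ} [Fact p.Prime] (hp : p ≠ 2) {a e w t z : ℚ_[p]}
    (ha : ‖a‖ = 1) (he : ‖e‖ = (p : ℝ)⁻¹) (htz : (t, z) ≠ (0, 0))
    (h : w ^ 2 = e * (t ^ 4 + 4 * a ^ 2 * z ^ 4)) : IsSquare (-1 : ℚ_[p]) ∧ IsSquare a := by
  have h2 := Padic.norm_two_eq_one hp
  have h4 : ‖(4 : ℚ_[p])‖ = 1 := by
    rw [show (4 : ℚ_[p]) = 2 * 2 by norm_num, norm_mul, h2, one_mul]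
  have hpar : ∀ c : ℚ_[p], c ≠ 0 → ‖t ^ 4 + 4 * a ^ 2 * z ^ 4‖ ≠ ‖c‖ ^ 2 := fun c hc hn =>
    Padic.norm_sq_ne_inv_mul_norm_sq hc (x := w) (by rw [← norm_pow, h, norm_mul, he, hn])
  have hn4 : ‖4 * a ^ 2 * z ^ 4‖ = ‖z ^ 2‖ ^ 2 := by
    rw [norm_mul, norm_mul, norm_pow, ha, h4, norm_pow, norm_pow]; ring
  have hn4' : ‖t ^ 4‖ = ‖t ^ 2‖ ^ 2 := by
    rw [norm_pow, norm_pow]; ring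
  have hlt : ∀ x y : ℚ_[p], ‖x‖ < ‖y‖ → ‖x ^ 2‖ ^ 2 < ‖y ^ 2‖ ^ 2 := fun x y hxy => by
    rw [norm_pow, norm_pow]; gcongr
  have heq : ‖t‖ = ‖z‖ := by
    rcases lt_trichotomy ‖t‖ ‖z‖ with hlt' | heq | hlt'
    · refine absurd ?_ (hpar (z ^ 2)
        (pow_ne_zero 2 (norm_pos_iff.1 ((norm_nonneg t).trans_lt hlt'))))
      rw [add_comm, ← hn4]
      exact Padic.norm_add_eq_left (by rw [hn4, hn4']; exact hlt _ _ hlt')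
    · exact heq
    · refine absurd ?_ (hpar (t ^ 2)
        (pow_ne_zero 2 (norm_pos_iff.1 ((norm_nonneg z).trans_lt hlt'))))
      rw [← hn4']
      exact Padic.norm_add_eq_left (by rw [hn4, hn4']; exact hlt _ _ hlt')
  have hz : z ≠ 0 := by
    rintro rfl
    rw [norm_zero, norm_eq_zero] at heq
    exact htz (by rw [heq])
  have ht : t ≠ 0 := by
    rintro rfl
    rw [norm_zero, eq_comm, norm_eq_zero] at heq
    exact hz heq
  have ha0 : a ≠ 0 := norm_ne_zero_iff.1 (by rw [ha]; exact one_ne_zero)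
  have hsmall : ‖t ^ 4 + 4 * a ^ 2 * z ^ 4‖ < ‖t ^ 2‖ ^ 2 := by
    refine lt_of_le_of_ne ((Padic.nonarchimedean _ _).trans (max_le hn4'.le ?_))
      (hpar _ (pow_ne_zero 2 ht))
    rw [hn4, norm_pow, norm_pow, heq]
  have hneg : IsSquare (-1 : ℚ_[p]) := by
    have : IsSquare (-(4 * a ^ 2 * z ^ 4)) := by
      refine Padic.isSquare_of_norm_sub_sq_lt (y := t ^ 2) ?_
      rw [h2, one_pow, one_mul, ← norm_neg]
      rwa [show -(-(4 * a ^ 2 * z ^ 4) - (t ^ 2) ^ 2) = t ^ 4 + 4 * a ^ 2 * z ^ 4 by ring]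
    have hdiv := this.div (IsSquare.sq (2 * a * z ^ 2))
    rwa [show -(4 * a ^ 2 * z ^ 4) / (2 * a * z ^ 2) ^ 2 = -1 by field_simp; ring] at hdiv
  refine ⟨hneg, ?_⟩
  obtain ⟨i, hi⟩ := hneg
  have hi0 : 1 + i ≠ 0 := by
    intro h0
    have h1 : i = -1 := by linear_combination h0
    rw [h1] at hi
    have : (2 : ℚ_[p]) = 0 := by linear_combination -hi
    simp at this
  have hprod : ‖t ^ 2 - 2 * a * i * z ^ 2‖ * ‖t ^ 2 + 2 * a * i * z ^ 2‖ < ‖t ^ 2‖ * ‖t ^ 2‖ := by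
    rw [← norm_mul, ← pow_two]
    convert hsmall using 2
    linear_combination 4 * a ^ 2 * z ^ 4 * hi
  have hsq : IsSquare (2 * a * i * z ^ 2) := by
    rcases lt_or_ge ‖t ^ 2 - 2 * a * i * z ^ 2‖ ‖t ^ 2‖ with hc | hc
    · refine Padic.isSquare_of_norm_sub_sq_lt (y := t) ?_
      rw [h2, one_pow, one_mul, norm_sub_rev, ← norm_pow]
      exact hc
    · have hc' : ‖t ^ 2 + 2 * a * i * z ^ 2‖ < ‖t ^ 2‖ := by
        by_contra! hge
        exact absurd hprod (mul_le_mul hc hge (norm_nonneg _) (norm_nonneg _)).not_gt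
      have hs : IsSquare (-(2 * a * i * z ^ 2)) := by
        refine Padic.isSquare_of_norm_sub_sq_lt (y := t) ?_
        rw [h2, one_pow, one_mul, ← norm_neg, ← norm_pow]
        rwa [show -(-(2 * a * i * z ^ 2) - t ^ 2) = t ^ 2 + 2 * a * i * z ^ 2 by ring]
      simpa using hs.mul (⟨i, hi⟩ : IsSquare (-1 : ℚ_[p]))
  have hdiv := hsq.div (IsSquare.sq ((1 + i) * z))
  have ha2 : a = 2 * a * i * z ^ 2 / ((1 + i) * z) ^ 2 := by
    rw [eq_div_iff (pow_ne_zero 2 (mul_ne_zero hi0 hz))]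
    linear_combination -a * z ^ 2 * hi
  rwa [← ha2] at hdiv

theorem Padic.isSquare_of_mul_sq_eq {p : ℕ} [Fact p.Prime] (hp : p ≠ 2) {e n w t z : ℚ_[p]}
    (he : ‖e‖ = 1) (hn : ‖n‖ = (p : ℝ)⁻¹) (htz : (t, z) ≠ (0, 0))
    (h : e * w ^ 2 = e ^ 2 * t ^ 4 + 4 * n ^ 2 * z ^ 4) : IsSquare e := by
  have hx : ‖e * t ^ 2‖ = ‖t‖ ^ 2 := by rw [norm_mul, he, one_mul, norm_pow]
  have hy : ‖2 * n * z ^ 2‖ = (p : ℝ)⁻¹ * ‖z‖ ^ 2 := by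
    rw [norm_mul, norm_mul, Padic.norm_two_eq_one hp, hn, one_mul, norm_pow]
  have hp0 : 0 < (p : ℝ) := by exact_mod_cast (Fact.out : p.Prime).pos
  have hne : ‖e * t ^ 2‖ ≠ ‖2 * n * z ^ 2‖ := by
    rw [hx, hy]
    rcases eq_or_ne z 0 with rfl | hz
    · have ht : t ≠ 0 := by
        rintro rfl
        exact htz rfl
      simpa using ht
    · exact Padic.norm_sq_ne_inv_mul_norm_sq hz
  rcases hne.lt_or_gt with hlt | hlt
  · exact Padic.isSquare_of_mul_sq_eq_add hp (w := w) (by rw [h]; ring) hlt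
  · exact Padic.isSquare_of_mul_sq_eq_add hp (w := w) (by rw [h]; ring) hlt

theorem ZMod.sq_eq_one_of_sq_add_sq_mul_eq {e n u b : ZMod 16} (he : Odd e) (hn : Odd n)
    (h : e ^ 2 * b ^ 4 + n ^ 2 = 2 * e * u ^ 2 ∨ e ^ 2 + n ^ 2 * b ^ 4 = 2 * e * u ^ 2) :
    n ^ 2 = 1 := by
  have hb : ∀ b : ZMod 16, b ^ 4 = 0 ∨ b ^ 4 = 1 := by decide
  have hu : ∀ u : ZMod 16, u ^ 2 = 0 ∨ u ^ 2 = 1 ∨ u ^ 2 = 4 ∨ u ^ 2 = 9 := by decide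
  obtain ⟨x, rfl⟩ := he
  obtain ⟨y, rfl⟩ := hn
  rcases hb b with hb | hb <;> rcases hu u with hu | hu | hu | hu <;> rw [hb, hu] at h <;>
    revert x y <;> decide

theorem Padic.norm_le_one_of_norm_two_mul_sq_le {u : ℚ_[2]} (h : ‖2 * u ^ 2‖ ≤ 1) : ‖u‖ ≤ 1 := by
  have h2 : ‖(2 : ℚ_[2])‖ = 2⁻¹ := by exact_mod_cast Padic.norm_p (p := 2)
  rw [norm_mul, norm_pow, h2] at h
  have := (Padic.norm_le_pow_iff_norm_lt_pow_add_one u 0).2 (by norm_num; nlinarith [norm_nonneg u])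
  simpa using this

theorem Padic.sq_zmod_eq_one {e n : ℤ} (he : Odd e) (hn : Odd n) {w t z : ℚ_[2]}
    (htz : (t, z) ≠ (0, 0))
    (h : 2 * e * w ^ 2 = e ^ 2 * t ^ 4 + n ^ 2 * z ^ 4) : ((n : ZMod 16)) ^ 2 = 1 := by
  have hZ : ∀ b u : ℚ_[2], ‖b‖ ≤ 1 →
      (e ^ 2 * b ^ 4 + n ^ 2 = 2 * e * u ^ 2 ∨ e ^ 2 + n ^ 2 * b ^ 4 = 2 * e * u ^ 2) →
      (n : ZMod 16) ^ 2 = 1 := by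
    intro b u hb hbu
    have he1 : ‖(e : ℚ_[2])‖ = 1 := Padic.norm_intCast_eq_one_of_not_dvd (by
      rw [Nat.cast_ofNat, ← even_iff_two_dvd, Int.not_even_iff_odd]; exact he)
    obtain ⟨b, rfl⟩ : ∃ b' : ℤ_[2], (b' : ℚ_[2]) = b := ⟨⟨b, hb⟩, rfl⟩
    have hu : ‖u‖ ≤ 1 := by
      refine Padic.norm_le_one_of_norm_two_mul_sq_le ?_
      have h1 : ‖2 * u ^ 2‖ = ‖2 * (e : ℚ_[2]) * u ^ 2‖ := by
        rw [norm_mul, norm_mul, norm_mul, he1, mul_one]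
      rw [h1]
      rcases hbu with hbu | hbu <;> rw [← hbu]
      · exact PadicInt.norm_le_one ((e : ℤ_[2]) ^ 2 * b ^ 4 + (n : ℤ_[2]) ^ 2)
      · exact PadicInt.norm_le_one ((e : ℤ_[2]) ^ 2 + (n : ℤ_[2]) ^ 2 * b ^ 4)
    obtain ⟨u, rfl⟩ : ∃ u' : ℤ_[2], (u' : ℚ_[2]) = u := ⟨⟨u, hu⟩, rfl⟩
    let f : ℤ_[2] →+* ZMod 16 := PadicInt.toZModPow 4
    refine ZMod.sq_eq_one_of_sq_add_sq_mul_eq (e := e) (u := f u) (b := f b)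
      (he.map (Int.castRingHom (ZMod 16))) (hn.map (Int.castRingHom (ZMod 16))) (hbu.imp ?_ ?_)
    · intro hbu
      have h' : (e : ℤ_[2]) ^ 2 * b ^ 4 + n ^ 2 = 2 * e * u ^ 2 := by
        apply Subtype.ext
        exact_mod_cast hbu
      simpa only [map_add, map_mul, map_pow, map_intCast, map_ofNat] using congrArg f h'
    · intro hbu
      have h' : (e : ℤ_[2]) ^ 2 + n ^ 2 * b ^ 4 = 2 * e * u ^ 2 := by
        apply Subtype.ext
        exact_mod_cast hbu
      simpa only [map_add, map_mul, map_pow, map_intCast, map_ofNat] using congrArg f h'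
  rcases le_or_gt ‖t‖ ‖z‖ with hle | hlt
  · have hz : z ≠ 0 := by
      rintro rfl
      rw [norm_zero, norm_le_zero_iff] at hle
      exact htz (by rw [hle])
    refine hZ (t / z) (w / z ^ 2) (by rw [norm_div]; exact div_le_one_of_le₀ hle (norm_nonneg _))
      (Or.inl ?_)
    field_simp
    linear_combination -h
  · have ht : t ≠ 0 := norm_pos_iff.1 ((norm_nonneg z).trans_lt hlt)
    refine hZ (z / t) (w / t ^ 2)
      (by rw [norm_div]; exact div_le_one_of_le₀ hlt.le (norm_nonneg _)) (Or.inr ?_)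
    field_simp
    linear_combination -h

theorem Padic.norm_intCast_eq_inv_of_squarefree {p : ℕ} [Fact p.Prime] {a : ℤ}
    (ha : Squarefree a) (hpa : (p : ℤ) ∣ a) : ‖(a : ℚ_[p])‖ = (p : ℝ)⁻¹ := by
  obtain ⟨b, rfl⟩ := hpa
  have hb : ¬(p : ℤ) ∣ b := fun hb =>
    (Nat.prime_iff_prime_int.1 Fact.out).not_isUnit (ha _ (mul_dvd_mul_left _ hb))
  rw [Int.cast_mul, norm_mul, Padic.norm_intCast_eq_one_of_not_dvd hb, mul_one, Int.cast_natCast,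
    Padic.norm_p]

theorem jacobiSym_eq_one_iff_isSquare_padic {p : ℕ} [Fact p.Prime] (hp : p ≠ 2) {a : ℤ}
    (ha : ¬(p : ℤ) ∣ a) : jacobiSym a p = 1 ↔ IsSquare (a : ℚ_[p]) := by
  rw [← jacobiSym.legendreSym.to_jacobiSym, Padic.isSquare_intCast_iff hp ha,
    legendreSym.eq_one_iff]
  rwa [Ne, ZMod.intCast_zmod_eq_zero_iff_dvd]

theorem padicSym_eq_one_iff {p : ℕ} [Fact p.Prime] {x : ℚ_[p]} :
    padicSym p x = 1 ↔ IsSquare x := by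
  unfold padicSym
  split_ifs with h <;> simp [h]

theorem Padic.isSquare_neg_one_iff {p : ℕ} [Fact p.Prime] (hp : p ≠ 2) :
    IsSquare (-1 : ℚ_[p]) ↔ p % 4 ≠ 3 := by
  have h : ¬(p : ℤ) ∣ -1 := by
    rw [dvd_neg]
    exact (Nat.prime_iff_prime_int.1 Fact.out).not_dvd_one
  have := Padic.isSquare_intCast_iff hp h
  push_cast at this
  rw [this, ZMod.exists_sq_eq_neg_one_iff]

theorem Int.dvd_of_dvd_two_mul {p : ℕ} (hp : p.Prime) (hp2 : p ≠ 2) {a : ℤ}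
    (h : (p : ℤ) ∣ 2 * a) : (p : ℤ) ∣ a :=
  ((Nat.prime_iff_prime_int.1 hp).dvd_or_dvd h).resolve_left fun h2 =>
    hp2 ((Nat.prime_dvd_prime_iff_eq hp Nat.prime_two).1 (by exact_mod_cast h2))

theorem Int.not_dvd_of_dvd_two_mul_div {n e : ℤ} (hsf : Squarefree n) (he : e ≠ 0)
    (hediv : e ∣ 2 * n) {p : ℕ} (hp : p.Prime) (hp2 : p ≠ 2) (hpd : (p : ℤ) ∣ 2 * n / e) :
    ¬(p : ℤ) ∣ e := by
  intro hpe
  obtain ⟨m, hm⟩ := hediv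
  rw [hm, Int.mul_ediv_cancel_left _ he] at hpd
  have hp' := Nat.prime_iff_prime_int.1 hp
  obtain ⟨k, rfl⟩ := Int.dvd_of_dvd_two_mul hp hp2 (hm ▸ hpe.mul_right m)
  have h1 : (p : ℤ) * p ∣ p * (2 * k) := by
    rw [mul_left_comm, hm]
    exact mul_dvd_mul hpe hpd
  have h2 := Int.dvd_of_dvd_two_mul hp hp2 ((mul_dvd_mul_iff_left hp'.ne_zero).1 h1)
  exact hp'.not_isUnit (hsf _ (mul_dvd_mul_left _ h2))

theorem Nat.mod_eight_of_sq_zmod_eq_one {n : ℕ} (h : (n : ZMod 16) ^ 2 = 1) :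
    n % 8 = 1 ∨ n % 8 = 7 := by
  have h1 : ((n ^ 2 : ℕ) : ZMod 16) = (1 : ℕ) := by exact_mod_cast h
  rw [ZMod.natCast_eq_natCast_iff', Nat.pow_mod] at h1
  have h2 : n % 16 < 16 := Nat.mod_lt _ (by norm_num)
  rw [← Nat.mod_mod_of_dvd n (by norm_num : 8 ∣ 16)]
  generalize n % 16 = r at *
  interval_cases r <;> simp_all

section LocalPoints

variable {n : ℕ} {e : ℤ}

theorem exists_padic_point_of_isSquare {p : ℕ} [Fact p.Prime] (h : IsSquare (e : ℚ_[p])) :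
    ∃ w t z : ℚ_[p], (t, z) ≠ (0, 0) ∧
      (e : ℚ_[p]) * w ^ 2 = (e : ℚ_[p]) ^ 2 * t ^ 4 + 4 * (n : ℚ_[p]) ^ 2 * z ^ 4 := by
  obtain ⟨s, hs⟩ := h
  exact ⟨s, 1, 0, by simp, by rw [hs]; ring⟩

theorem exists_padic_point_of_isSquare_div {p : ℕ} [Fact p.Prime] (he : e ≠ 0)
    (hi : IsSquare (-1 : ℚ_[p])) (h : IsSquare ((n : ℚ_[p]) / e)) :
    ∃ w t z : ℚ_[p], (t, z) ≠ (0, 0) ∧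
      (e : ℚ_[p]) * w ^ 2 = (e : ℚ_[p]) ^ 2 * t ^ 4 + 4 * (n : ℚ_[p]) ^ 2 * z ^ 4 := by
  obtain ⟨i, hi⟩ := hi
  obtain ⟨s, hs⟩ := h
  have he' : (e : ℚ_[p]) ≠ 0 := by exact_mod_cast he
  rw [div_eq_iff he'] at hs
  refine ⟨0, s * (i - 1), 1, by simp, ?_⟩
  have h4 : (i - 1) ^ 4 = -4 := by linear_combination (-(i ^ 2) + 4 * i - 5) * hi
  rw [hs, mul_pow, h4]
  ring

theorem exists_two_adic_point_of_odd (hn : Odd n) (he : e % 4 = 1) :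
    ∃ w t z : ℚ_[2], (t, z) ≠ (0, 0) ∧
      (e : ℚ_[2]) * w ^ 2 = (e : ℚ_[2]) ^ 2 * t ^ 4 + 4 * (n : ℚ_[2]) ^ 2 * z ^ 4 := by
  have he2 : ¬(2 : ℤ) ∣ e := by omega
  have he0 : (e : ℚ_[2]) ≠ 0 := by
    have : e ≠ 0 := by omega
    exact_mod_cast this
  obtain h8 | h8 : e % 8 = 1 ∨ e % 8 = 5 := by omega
  · have h := Padic.isSquare_intCast_div (a := e) (b := 1) (by norm_num) (by omega)
    rw [Int.cast_one, div_one] at h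
    exact exists_padic_point_of_isSquare h
  · obtain ⟨k, hk⟩ := hn
    obtain ⟨l, rfl⟩ : ∃ l, e = 8 * l + 5 := ⟨e / 8, by omega⟩
    obtain ⟨s, hs⟩ := Padic.isSquare_intCast_div (a := (8 * l + 5) ^ 2 + 4 * n ^ 2) he2
      (by
        rw [hk]; push_cast
        exact ⟨8 * l ^ 2 + 9 * l + 3 + 2 * k ^ 2 + 2 * k, by ring⟩)
    rw [div_eq_iff he0] at hs
    refine ⟨s, 1, 1, by simp, ?_⟩
    push_cast at hs ⊢
    linear_combination -hs

theorem exists_two_adic_point_of_even {d : ℤ} (hn : n % 8 = 1 ∨ n % 8 = 7) (hd : d % 4 = 1) :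
    ∃ w t z : ℚ_[2], (t, z) ≠ (0, 0) ∧
      ((2 * d : ℤ) : ℚ_[2]) * w ^ 2 =
        ((2 * d : ℤ) : ℚ_[2]) ^ 2 * t ^ 4 + 4 * (n : ℚ_[2]) ^ 2 * z ^ 4 := by
  have hd2 : ¬(2 : ℤ) ∣ d := by omega
  have hd0 : (d : ℚ_[2]) ≠ 0 := by
    have : d ≠ 0 := by omega
    exact_mod_cast this
  obtain ⟨k, hk⟩ : ∃ k : ℤ, d ^ 2 + (n : ℤ) ^ 2 = 2 * d + 16 * k := by
    obtain ⟨l, rfl⟩ : ∃ l, d = 4 * l + 1 := ⟨d / 4, by omega⟩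
    have hn' : ∃ j : ℤ, (n : ℤ) ^ 2 = 16 * j + 1 := by
      rcases hn with hn | hn
      · obtain ⟨j, hj⟩ : ∃ j : ℤ, (n : ℤ) = 8 * j + 1 := ⟨n / 8, by omega⟩
        exact ⟨4 * j ^ 2 + j, by rw [hj]; ring⟩
      · obtain ⟨j, hj⟩ : ∃ j : ℤ, (n : ℤ) = 8 * j + 7 := ⟨n / 8, by omega⟩
        exact ⟨4 * j ^ 2 + 7 * j + 3, by rw [hj]; ring⟩
    obtain ⟨j, hj⟩ := hn'
    exact ⟨l ^ 2 + j, by rw [hj]; ring⟩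
  obtain ⟨s, hs⟩ := Padic.isSquare_intCast_div (a := d + 8 * k) hd2 (by simp)
  rw [div_eq_iff hd0] at hs
  have hk' : (d : ℚ_[2]) ^ 2 + (n : ℚ_[2]) ^ 2 = 2 * d + 16 * k := by exact_mod_cast hk
  refine ⟨2 * s, 1, 1, by simp, ?_⟩
  push_cast at hs ⊢
  linear_combination -8 * hs - 4 * hk'

theorem exists_two_adic_point (hn : Odd n) (hesf : Squarefree e) (he : 0 < e)
    (h3 : ∀ p : ℕ, p.Prime → p % 4 = 3 → ¬(p : ℤ) ∣ e)
    (h8 : (2 : ℤ) ∣ e → n % 8 = 1 ∨ n % 8 = 7) :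
    ∃ w t z : ℚ_[2], (t, z) ≠ (0, 0) ∧
      (e : ℚ_[2]) * w ^ 2 = (e : ℚ_[2]) ^ 2 * t ^ 4 + 4 * (n : ℚ_[2]) ^ 2 * z ^ 4 := by
  have hmod : ∀ d : ℤ, 0 < d → d ∣ e → ¬(2 : ℤ) ∣ d → d % 4 = 1 := by
    intro d hd hde hd2
    lift d to ℕ using hd.le
    have := Nat.mod_four_eq_one_of_prime_dvd (m := d) (Nat.odd_iff.2 (by omega))
      fun p hp hp3 hpd => h3 p hp hp3 ((Int.natCast_dvd_natCast.2 hpd).trans hde)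
    omega
  by_cases h2 : (2 : ℤ) ∣ e
  · have hn8 := h8 h2
    obtain ⟨d, rfl⟩ := h2
    refine exists_two_adic_point_of_even hn8 (hmod d (by omega) (dvd_mul_left d 2) fun h2d => ?_)
    exact Int.prime_two.not_isUnit (hesf 2 (mul_dvd_mul_left 2 h2d))
  · exact exists_two_adic_point_of_odd hn (hmod e he dvd_rfl h2)

theorem isSquare_of_padic_point {p : ℕ} [Fact p.Prime] (hp2 : p ≠ 2) (hsf : Squarefree n)
    (hesf : Squarefree e) (hediv : e ∣ 2 * n) (hpe : (p : ℤ) ∣ e)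
    (h : ∃ w t z : ℚ_[p], (t, z) ≠ (0, 0) ∧
      (e : ℚ_[p]) * w ^ 2 = (e : ℚ_[p]) ^ 2 * t ^ 4 + 4 * (n : ℚ_[p]) ^ 2 * z ^ 4) :
    IsSquare (-1 : ℚ_[p]) ∧ IsSquare ((n : ℚ_[p]) / e) := by
  have hpn := Int.dvd_of_dvd_two_mul Fact.out hp2 (hpe.trans hediv)
  have hne := Padic.norm_intCast_eq_inv_of_squarefree hesf hpe
  have hnn := Padic.norm_intCast_eq_inv_of_squarefree (Int.squarefree_natCast.2 hsf) hpn
  have he0 : (e : ℚ_[p]) ≠ 0 := by exact_mod_cast hesf.ne_zero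
  obtain ⟨w, t, z, htz, h⟩ := h
  refine Padic.isSquare_of_sq_eq_mul_add hp2 (w := w) ?_ hne htz ?_
  · rw [norm_div, hne, ← hnn, Int.cast_natCast, div_self]
    rw [← Int.cast_natCast, hnn]
    exact inv_ne_zero (by exact_mod_cast (Fact.out : p.Prime).ne_zero)
  · field_simp
    linear_combination h

end LocalPoints

/-- Local solvability of `C_e : e·w² = e²t⁴ + 4n²z⁴` for a squarefree divisor `e` of `2n`. -/
theorem sLocSolvC_iff
    (n : ℕ) (hodd : Odd n) (hpos : 0 < n) (hsf : Squarefree n)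
    (e : ℤ) (hesf : Squarefree e) (hediv : e ∣ 2 * n) :
    SLocSolvC n e ↔
      (0 < e ∧ ∀ p : ℕ, p.Prime → p % 4 = 3 → ¬(p : ℤ) ∣ e) ∧
      (∀ (p : ℕ) [Fact p.Prime], p ≠ 2 → (p : ℤ) ∣ e →
        padicSym p ((n : ℚ_[p]) / (e : ℚ_[p])) = 1) ∧
      (∀ (p : ℕ) [Fact p.Prime], p ≠ 2 → (p : ℤ) ∣ (2 * n / e) → jacobiSym e p = 1) ∧
      ((2 : ℤ) ∣ e → n % 8 = 1 ∨ n % 8 = 7) := by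
  have he0 : e ≠ 0 := hesf.ne_zero
  have hsf' : Squarefree (n : ℤ) := Int.squarefree_natCast.2 hsf
  constructor
  · rintro ⟨⟨w, t, z, htz, hR⟩, hloc⟩
    have hodd_dvd : ∀ (p : ℕ) [Fact p.Prime], p ≠ 2 → (p : ℤ) ∣ e →
        IsSquare (-1 : ℚ_[p]) ∧ IsSquare ((n : ℚ_[p]) / e) := fun p _ hp2 hpe =>
      isSquare_of_padic_point hp2 hsf hesf hediv hpe
        (hloc p (by exact_mod_cast hpe.trans hediv))
    refine ⟨⟨?_, ?_⟩, ?_, ?_, ?_⟩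
    · by_contra hneg
      have he : (e : ℝ) < 0 := by exact_mod_cast lt_of_le_of_ne (not_lt.1 hneg) he0
      have hn : (0 : ℝ) < n := by exact_mod_cast hpos
      have hl : (e : ℝ) * w ^ 2 ≤ 0 := mul_nonpos_of_nonpos_of_nonneg he.le (sq_nonneg w)
      have ht : 0 ≤ (e : ℝ) ^ 2 * t ^ 4 := by positivity
      have hz : 0 ≤ 4 * (n : ℝ) ^ 2 * z ^ 4 := by positivity
      have ht0 : (e : ℝ) ^ 2 * t ^ 4 = 0 := by linarith
      have hz0 : 4 * (n : ℝ) ^ 2 * z ^ 4 = 0 := by linarith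
      simp only [mul_eq_zero, pow_eq_zero_iff two_ne_zero, pow_eq_zero_iff four_ne_zero, he.ne,
        hn.ne', OfNat.ofNat_ne_zero, false_or] at ht0 hz0
      exact htz (by rw [ht0, hz0])
    · intro p hp hp3 hpe
      have := Fact.mk hp
      have hp2 : p ≠ 2 := by rintro rfl; simp at hp3
      exact (Padic.isSquare_neg_one_iff hp2).1 (hodd_dvd p hp2 hpe).1 hp3
    · intro p _ hp2 hpe
      exact padicSym_eq_one_iff.2 (hodd_dvd p hp2 hpe).2
    · intro p _ hp2 hpd
      have hpe := Int.not_dvd_of_dvd_two_mul_div hsf' he0 hediv Fact.out hp2 hpd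
      have hpn2 : (p : ℤ) ∣ 2 * n := hpd.trans (Int.ediv_dvd_of_dvd hediv)
      have hpn := Int.dvd_of_dvd_two_mul Fact.out hp2 hpn2
      rw [jacobiSym_eq_one_iff_isSquare_padic hp2 hpe]
      obtain ⟨w, t, z, htz, h⟩ := hloc p (by exact_mod_cast hpn2)
      have hnn := Padic.norm_intCast_eq_inv_of_squarefree hsf' hpn
      rw [Int.cast_natCast] at hnn
      exact Padic.isSquare_of_mul_sq_eq hp2 (Padic.norm_intCast_eq_one_of_not_dvd hpe) hnn htz h
    · rintro ⟨d, rfl⟩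
      have hd : Odd d := by
        rw [← Int.not_even_iff_odd, even_iff_two_dvd]
        exact fun h2d => Int.prime_two.not_isUnit (hesf 2 (mul_dvd_mul_left 2 h2d))
      obtain ⟨w, t, z, htz, h⟩ := hloc 2 (dvd_mul_right 2 n)
      refine Nat.mod_eight_of_sq_zmod_eq_one ?_
      have := Padic.sq_zmod_eq_one (n := n) (w := w / 2) hd (by exact_mod_cast hodd) htz (by
        push_cast at h ⊢
        linear_combination h / 4)
      exact_mod_cast this
  · rintro ⟨⟨he, h3⟩, hpe, hpd, h8⟩
    refine ⟨⟨√e, 1, 0, by simp, ?_⟩, ?_⟩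
    · rw [Real.sq_sqrt (by exact_mod_cast he.le)]
      ring
    · intro p _ hpn
      rcases eq_or_ne p 2 with rfl | hp2
      · exact exists_two_adic_point hodd hesf he h3 h8
      by_cases hp : (p : ℤ) ∣ e
      · refine exists_padic_point_of_isSquare_div he0 ((Padic.isSquare_neg_one_iff hp2).2
          fun hp3 => h3 p Fact.out hp3 hp) (padicSym_eq_one_iff.1 (hpe p hp2 hp))
      · refine exists_padic_point_of_isSquare
          ((jacobiSym_eq_one_iff_isSquare_padic hp2 hp).1 (hpd p hp2 ?_))
        have hpn' : (p : ℤ) ∣ 2 * n := by exact_mod_cast hpn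
        rw [← Int.mul_ediv_cancel' hediv] at hpn'
        exact ((Nat.prime_iff_prime_int.1 Fact.out).dvd_or_dvd hpn').resolve_left hp

end
end

section
/- Let d and m be odd integers with d ≠ 0. Then there exists (w,t,z) ∈ ℚ₂³ with (t,z) ≠ (0,0) satisfying w² = d(t⁴ + 4m²z⁴) if and only if d ≡ 1 (mod 4). -/
noncomputable section

/-- An integer congruent to `1` modulo `8` is a square in `ℚ₂`. -/
theorem Padic.exists_sq_eq_intCast_of_emod_eight_eq_one {a : ℤ} (ha : a % 8 = 1) :
    ∃ w : ℚ_[2], w ^ 2 = (a : ℚ_[2]) := by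
  have hnorm : ‖((1 - a : ℤ) : ℤ_[2])‖ ≤ (2 : ℝ) ^ (-(3 : ℕ) : ℤ) := by
    have h := (PadicInt.norm_int_le_pow_iff_dvd (p := 2) (k := 1 - a) (n := 3)).2
      (by norm_num; omega)
    exact_mod_cast h
  have htwo : ‖(2 : ℤ_[2])‖ = 2⁻¹ := by
    simpa using PadicInt.norm_p (p := 2)
  obtain ⟨z, hz, -⟩ := hensels_lemma (p := 2) (R := ℤ_[2])
    (F := (Polynomial.X ^ 2 - Polynomial.C (a : ℤ_[2]))) (a := 1) (by
      push_cast at hnorm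
      simp only [map_sub, map_pow, Polynomial.aeval_X, Polynomial.aeval_C, one_pow,
        Polynomial.derivative_X_sq, Polynomial.derivative_C,
        sub_zero, map_mul, mul_one, Algebra.algebraMap_self_apply, htwo]
      refine hnorm.trans_lt ?_
      norm_num)
  refine ⟨z, ?_⟩
  have hz' : z ^ 2 = (a : ℤ_[2]) := by
    simpa [sub_eq_zero] using hz
  exact_mod_cast congrArg (fun y : ℤ_[2] => (y : ℚ_[2])) hz'

/-- If `d * (m ^ 2 + 4 * x)` is a square in `ℚ₂`, with `d` and `m` odd integers and `x` a `2`-adic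
integer, then `d` is congruent to `1` modulo `4`. -/
theorem Padic.emod_four_eq_one_of_sq_eq {d m : ℤ} (hd : Odd d) (hm : Odd m) {u : ℚ_[2]}
    {x : ℤ_[2]} (h : u ^ 2 = (d : ℚ_[2]) * ((m : ℚ_[2]) ^ 2 + 4 * (x : ℚ_[2]))) :
    d % 4 = 1 := by
  have hint : u ^ 2 = (((d : ℤ_[2]) * ((m : ℤ_[2]) ^ 2 + 4 * x) : ℤ_[2]) : ℚ_[2]) := by
    rw [h]; push_cast; rfl
  have hu : ‖u‖ ≤ 1 := by
    have hsq : ‖u‖ ^ 2 ≤ 1 := by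
      rw [← norm_pow, hint]
      exact PadicInt.norm_le_one _
    exact (sq_le_one_iff₀ (norm_nonneg u)).1 hsq
  obtain ⟨u, rfl⟩ : ∃ y : ℤ_[2], (y : ℚ_[2]) = u := ⟨⟨u, hu⟩, rfl⟩
  have hmod : u ^ 2 = (d : ℤ_[2]) * ((m : ℤ_[2]) ^ 2 + 4 * x) := by
    exact PadicInt.ext (by rw [PadicInt.coe_pow, hint])
  have key := congrArg (PadicInt.toZModPow 2) hmod
  simp only [map_pow, map_mul, map_add, map_intCast, map_ofNat] at key
  generalize PadicInt.toZModPow 2 u = v at key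
  generalize PadicInt.toZModPow 2 x = y at key
  by_contra hne
  have hdmod : (d : ZMod (2 ^ 2)) = ((3 : ℤ) : ZMod (2 ^ 2)) := by
    rw [ZMod.intCast_eq_intCast_iff]
    have := Int.odd_iff.1 hd
    simp only [Int.ModEq]; norm_num; omega
  have hmmod : (m : ZMod (2 ^ 2)) ^ 2 = ((1 : ℤ) : ZMod (2 ^ 2)) := by
    obtain ⟨k, rfl⟩ := hm
    push_cast
    generalize (k : ZMod (2 ^ 2)) = l
    revert l; decide
  rw [hdmod, hmmod] at key
  revert v y; decide

/-- For odd `d ≠ 0` and odd `m`, the equation `w² = d(t⁴ + 4m²z⁴)` has a nontrivial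
`ℚ₂`-point iff `d ≡ 1 (mod 4)`. -/
theorem qtwo_solvable_iff (d m : ℤ) (hd : Odd d) (hm : Odd m) (hd0 : d ≠ 0) :
    (∃ w t z : ℚ_[2], (t, z) ≠ (0, 0) ∧
      w ^ 2 = (d : ℚ_[2]) * (t ^ 4 + 4 * (m : ℚ_[2]) ^ 2 * z ^ 4)) ↔ d % 4 = 1 := by
  constructor
  · rintro ⟨w, t, z, hne, h⟩
    rcases le_or_gt ‖z‖ ‖t‖ with hle | hlt
    · have ht : t ≠ 0 := by
        rintro rfl
        exact hne (by simpa using hle)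
      obtain ⟨s, hs⟩ : ∃ s : ℤ_[2], (s : ℚ_[2]) = z / t :=
        ⟨⟨z / t, by rw [norm_div]; exact div_le_one_of_le₀ hle (norm_nonneg t)⟩, rfl⟩
      refine Padic.emod_four_eq_one_of_sq_eq (m := 1) (u := w / t ^ 2)
        (x := (m : ℤ_[2]) ^ 2 * s ^ 4) hd odd_one ?_
      rw [PadicInt.coe_mul, PadicInt.coe_pow, PadicInt.coe_pow, PadicInt.coe_intCast, hs]
      push_cast
      field_simp
      linear_combination h
    · have hz : z ≠ 0 := norm_pos_iff.1 ((norm_nonneg t).trans_lt hlt)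
      have hq : ‖t / z‖ < 1 := by
        rw [norm_div]
        exact (div_lt_one (norm_pos_iff.2 hz)).2 hlt
      obtain ⟨s, hs⟩ := (PadicInt.norm_lt_one_iff_dvd (p := 2) ⟨t / z, hq.le⟩).1 hq
      have hs' : t = 2 * s * z := by
        rw [← div_eq_iff hz]
        exact_mod_cast congrArg (fun y : ℤ_[2] => (y : ℚ_[2])) hs
      refine Padic.emod_four_eq_one_of_sq_eq (u := w / (2 * z ^ 2)) (x := s ^ 4) hd hm ?_
      push_cast
      field_simp
      rw [h, hs']
      ring
  · intro hd4
    rcases (by omega : d % 8 = 1 ∨ d % 8 = 5) with h1 | h5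
    · obtain ⟨w, hw⟩ := Padic.exists_sq_eq_intCast_of_emod_eight_eq_one h1
      exact ⟨w, 1, 0, by simp, by simp [hw]⟩
    · have hm8 : (1 + 4 * m ^ 2) % 8 = 5 := by
        have := Int.odd_iff.1 (hm.pow (n := 2))
        omega
      obtain ⟨w, hw⟩ := Padic.exists_sq_eq_intCast_of_emod_eight_eq_one
        (a := d * (1 + 4 * m ^ 2)) (by rw [Int.mul_emod, h5, hm8]; rfl)
      exact ⟨w, 1, 1, by simp, by rw [hw]; push_cast; ring⟩

end
end

section
/- Let n be an odd positive squarefree integer, d an odd positive divisor of n, and p an odd prime dividing d. Then there exists (w,t,z) ∈ ℚ_p³ with (t,z) ≠ (0,0) satisfying w² = d(t⁴ + 4(n/d)²z⁴) if and only if the Legendre symbol (n/d / p) = 1 and p ≡ 1 (mod 4). -/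
noncomputable section

theorem ZMod.ne_zero_of_pow_four_eq {p : ℕ} [Fact p.Prime] (hp2 : p ≠ 2) {m r : ZMod p}
    (hm : m ≠ 0) (hr : r ^ 4 + 4 * m ^ 2 = 0) : r ≠ 0 := by
  have h2 : (2 : ZMod p) ≠ 0 := Ring.two_ne_zero (by rwa [ZMod.ringChar_zmod_n])
  rintro rfl
  have : (2 * m) ^ 2 = 0 := by linear_combination hr
  exact mul_ne_zero h2 hm (pow_eq_zero_iff two_ne_zero |>.1 this)

/-- For `m ≠ 0`, a root of `X⁴ + 4m²` mod `p` exists only if `-1` and `m` are squares. -/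
theorem ZMod.isSquare_of_pow_four_eq {p : ℕ} [Fact p.Prime] (hp2 : p ≠ 2) {m r : ZMod p}
    (hm : m ≠ 0) (hr : r ^ 4 + 4 * m ^ 2 = 0) : IsSquare (-1 : ZMod p) ∧ IsSquare m := by
  have h2 : (2 : ZMod p) ≠ 0 := Ring.two_ne_zero (by rwa [ZMod.ringChar_zmod_n])
  set i := r ^ 2 / (2 * m) with hi
  have hri : r ^ 2 = 2 * m * i := by rw [hi]; field_simp
  have hi2 : i ^ 2 = -1 := by
    have : (2 * m) ^ 2 * (i ^ 2 + 1) = 0 := by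
      linear_combination hr - (r ^ 2 + 2 * m * i) * hri
    have := (mul_eq_zero.1 this).resolve_left (pow_ne_zero 2 (mul_ne_zero h2 hm))
    linear_combination this
  have h1i : 1 + i ≠ 0 := by
    intro h
    exact h2 (by linear_combination hi2 + (1 - i) * h)
  refine ⟨⟨i, by rw [← hi2, sq]⟩, ⟨r / (1 + i), ?_⟩⟩
  field_simp
  linear_combination m * hi2 - hri

/-- If `-1` and `m` are squares mod `p`, then `X⁴ + 4m²` has a root mod `p`. -/
theorem ZMod.exists_pow_four_eq {p : ℕ} {m : ZMod p} (h : IsSquare (-1 : ZMod p))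
    (hm : IsSquare m) : ∃ r : ZMod p, r ^ 4 + 4 * m ^ 2 = 0 := by
  obtain ⟨i, hi⟩ := h
  obtain ⟨s, rfl⟩ := hm
  exact ⟨(1 + i) * s, by linear_combination -s ^ 4 * (i ^ 2 + 4 * i + 5) * hi⟩

theorem PadicInt.toZMod_eq_zero_iff_norm_lt_one {p : ℕ} [Fact p.Prime] {x : ℤ_[p]} :
    PadicInt.toZMod x = 0 ↔ ‖x‖ < 1 := by
  rw [← RingHom.mem_ker, PadicInt.ker_toZMod, IsLocalRing.mem_maximalIdeal,
    PadicInt.mem_nonunits]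

open Polynomial in
/-- A simple root modulo `p` of an integral polynomial lifts to `ℤ_p`. -/
theorem PadicInt.exists_root_of_toZMod {p : ℕ} [Fact p.Prime] (F : ℤ_[p][X]) (a : ℤ_[p])
    (h : PadicInt.toZMod (F.eval a) = 0) (h' : PadicInt.toZMod (F.derivative.eval a) ≠ 0) :
    ∃ z : ℤ_[p], F.eval z = 0 := by
  have hd : ‖F.derivative.eval a‖ = 1 :=
    le_antisymm (PadicInt.norm_le_one _)
      (not_lt.1 (mt PadicInt.toZMod_eq_zero_iff_norm_lt_one.2 h'))
  obtain ⟨z, hz, -⟩ := hensels_lemma (F := F) (a := a) (by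
    simp only [coe_aeval_eq_eval]
    rw [hd, one_pow]
    exact PadicInt.toZMod_eq_zero_iff_norm_lt_one.1 h)
  exact ⟨z, by simpa using hz⟩

theorem PadicInt.coe_four {p : ℕ} [Fact p.Prime] : ((4 : ℤ_[p]) : ℚ_[p]) = 4 :=
  map_ofNat PadicInt.Coe.ringHom 4

theorem PadicInt.toZMod_four {p : ℕ} [Fact p.Prime] : PadicInt.toZMod (4 : ℤ_[p]) = 4 :=
  map_ofNat PadicInt.toZMod 4

theorem Padic.sq_ne_mul_pow_four {p : ℕ} [Fact p.Prime] {d w y e : ℚ_[p]}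
    (hd : d.valuation = 1) (hy : y ≠ 0) (he : ‖e‖ = 1) : w ^ 2 ≠ d * (y ^ 4 * e) := by
  intro h
  have he0 : e ≠ 0 := norm_ne_zero_iff.1 (by simp [he])
  have hd0 : d ≠ 0 := by rintro rfl; simp at hd
  have hev : e.valuation = 0 := by
    have := Padic.norm_eq_zpow_neg_valuation he0
    rw [he, eq_comm, zpow_eq_one_iff_right₀ (by positivity)
      (by exact_mod_cast (Fact.out : p.Prime).one_lt.ne')] at this
    omega
  have := congrArg Padic.valuation h
  rw [Padic.valuation_mul hd0 (mul_ne_zero (pow_ne_zero 4 hy) he0),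
    Padic.valuation_mul (pow_ne_zero 4 hy) he0, Padic.valuation_pow, Padic.valuation_pow,
    hd, hev] at this
  push_cast at this
  omega

theorem Padic.exists_toZMod_root_of_sq_eq {p : ℕ} [Fact p.Prime] {d w t z : ℚ_[p]} (m : ℤ_[p])
    (hd : d.valuation = 1) (htz : (t, z) ≠ (0, 0))
    (h : w ^ 2 = d * (t ^ 4 + 4 * (m : ℚ_[p]) ^ 2 * z ^ 4)) :
    ∃ r : ZMod p, r ^ 4 + 4 * PadicInt.toZMod m ^ 2 = 0 := by
  rcases le_or_gt ‖t‖ ‖z‖ with hle | hlt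
  · have hz : z ≠ 0 := by
      rintro rfl
      rw [norm_zero] at hle
      exact htz (by rw [norm_le_zero_iff.1 hle])
    let r : ℤ_[p] := ⟨t / z, by rw [norm_div]; exact div_le_one_of_le₀ hle (norm_nonneg _)⟩
    have hrz : (r : ℚ_[p]) * z = t := div_mul_cancel₀ t hz
    refine ⟨PadicInt.toZMod r, ?_⟩
    have hlt : ‖r ^ 4 + 4 * m ^ 2‖ < 1 := by
      refine lt_of_le_of_ne (PadicInt.norm_le_one _) fun he => ?_
      refine Padic.sq_ne_mul_pow_four (w := w) (e := ((r ^ 4 + 4 * m ^ 2 : ℤ_[p]) : ℚ_[p])) hd hz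
        (by rw [← PadicInt.norm_def, he]) ?_
      rw [h, ← hrz]
      push_cast [PadicInt.coe_four]
      ring
    simpa [PadicInt.toZMod_four] using PadicInt.toZMod_eq_zero_iff_norm_lt_one.2 hlt
  · have ht : t ≠ 0 := norm_pos_iff.1 ((norm_nonneg z).trans_lt hlt)
    have hs : ‖z / t‖ < 1 := by rwa [norm_div, div_lt_one (norm_pos_iff.2 ht)]
    let s : ℤ_[p] := ⟨z / t, hs.le⟩
    have hst : (s : ℚ_[p]) * t = z := div_mul_cancel₀ z ht
    have hs0 : PadicInt.toZMod s = 0 := PadicInt.toZMod_eq_zero_iff_norm_lt_one.2 hs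
    have he : ‖1 + 4 * m ^ 2 * s ^ 4‖ = 1 := by
      refine le_antisymm (PadicInt.norm_le_one _) (not_lt.1 fun hlt => ?_)
      have := PadicInt.toZMod_eq_zero_iff_norm_lt_one.2 hlt
      simp [hs0] at this
    refine absurd ?_ (Padic.sq_ne_mul_pow_four (w := w)
      (e := ((1 + 4 * m ^ 2 * s ^ 4 : ℤ_[p]) : ℚ_[p])) hd ht (by rw [← PadicInt.norm_def, he]))
    rw [h, ← hst]
    push_cast [PadicInt.coe_four]
    ring

open Polynomial in
theorem PadicInt.exists_pow_four_eq {p : ℕ} [Fact p.Prime] (hp2 : p ≠ 2) {m : ℤ_[p]}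
    (hm : PadicInt.toZMod m ≠ 0) {r : ZMod p} (hr : r ^ 4 + 4 * PadicInt.toZMod m ^ 2 = 0) :
    ∃ x : ℤ_[p], x ^ 4 + 4 * m ^ 2 = 0 := by
  have h2 : (2 : ZMod p) ≠ 0 := Ring.two_ne_zero (by rwa [ZMod.ringChar_zmod_n])
  have hr0 : r ≠ 0 := ZMod.ne_zero_of_pow_four_eq hp2 hm hr
  obtain ⟨a, rfl⟩ := ZMod.ringHom_surjective (PadicInt.toZMod (p := p)) r
  obtain ⟨x, hx⟩ := PadicInt.exists_root_of_toZMod (X ^ 4 + C (4 * m ^ 2)) a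
    (by simpa [PadicInt.toZMod_four] using hr) (by
      have h4 : (4 : ZMod p) ≠ 0 := by
        rw [show (4 : ZMod p) = 2 * 2 by norm_num]
        exact mul_ne_zero h2 h2
      rw [derivative_add, derivative_C, add_zero, derivative_X_pow]
      rw [eval_mul, eval_pow, eval_X, eval_C, map_mul, map_pow, map_natCast]
      exact mul_ne_zero h4 (pow_ne_zero 3 hr0))
  exact ⟨x, by simpa using hx⟩

/-- For `p` an odd prime dividing the odd positive divisor `d` of `n`, the equation
`w² = d(t⁴ + 4(n/d)²z⁴)` has a nontrivial `ℚ_p`-point iff `(n/d / p) = 1` and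
`p ≡ 1 (mod 4)`. -/
theorem qp_solvable_iff
    (n d p : ℕ) [Fact p.Prime] (hodd : Odd n) (hpos : 0 < n) (hsf : Squarefree n)
    (hd : Odd d) (hdpos : 0 < d) (hdvd : d ∣ n) (hp2 : p ≠ 2) (hpd : p ∣ d) :
    (∃ w t z : ℚ_[p], (t, z) ≠ (0, 0) ∧
      w ^ 2 = (d : ℚ_[p]) * (t ^ 4 + 4 * ((n / d : ℕ) : ℚ_[p]) ^ 2 * z ^ 4)) ↔
    jacobiSym ((n : ℤ) / d) p = 1 ∧ p % 4 = 1 := by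
  have hp : p.Prime := Fact.out
  obtain ⟨m, rfl⟩ := hdvd
  rw [Nat.mul_div_cancel_left m hdpos, Nat.cast_mul,
    Int.mul_ediv_cancel_left (m : ℤ) (by exact_mod_cast hdpos.ne'),
    ← jacobiSym.legendreSym.to_jacobiSym]
  have hpm : ¬ p ∣ m := fun h =>
    hp.not_isUnit (hsf p (mul_dvd_mul hpd h))
  have hm : (m : ZMod p) ≠ 0 := by rwa [Ne, ZMod.natCast_eq_zero_iff]
  have hdv : (d : ℚ_[p]).valuation = 1 := by
    rw [Padic.valuation_natCast]
    have h1 : 1 ≤ padicValNat p d := one_le_padicValNat_of_dvd hdpos.ne' hpd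
    have h2 : padicValNat p d < 2 := by
      refine not_le.1 fun h => hp.not_isUnit (hsf p ?_)
      rw [← sq]
      exact ((padicValNat_dvd_iff_le hdpos.ne').2 h).trans (dvd_mul_right d m)
    exact_mod_cast (by omega : padicValNat p d = 1)
  have hp4 : p % 4 = 1 ↔ IsSquare (-1 : ZMod p) := by
    rw [ZMod.exists_sq_eq_neg_one_iff]
    have := hp.eq_two_or_odd
    omega
  rw [legendreSym.eq_one_iff' p hm, hp4]
  constructor
  · rintro ⟨w, t, z, htz, h⟩
    obtain ⟨r, hr⟩ := Padic.exists_toZMod_root_of_sq_eq (m : ℤ_[p]) hdv htz (by simpa using h)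
    rw [map_natCast] at hr
    exact (ZMod.isSquare_of_pow_four_eq hp2 hm hr).symm
  · rintro ⟨hms, h1⟩
    obtain ⟨r, hr⟩ := ZMod.exists_pow_four_eq h1 hms
    obtain ⟨x, hx⟩ := PadicInt.exists_pow_four_eq (m := (m : ℤ_[p])) hp2 (by simpa using hm)
      (by simpa using hr)
    refine ⟨0, x, 1, by simp, ?_⟩
    have := congrArg ((↑) : ℤ_[p] → ℚ_[p]) hx
    push_cast [PadicInt.coe_four] at this
    linear_combination -(d : ℚ_[p]) * this

end
end

section
/- Let n be an odd positive squarefree integer and e a (possibly negative) squarefree divisor of 2n. Then the curve C'_e : e·w² = e²t⁴ − n²z⁴ is S-locally solvable if and only if all of the following hold: (1) e is odd, and e ≡ ±1 (mod 8) or n/e ≡ ±1 (mod 8); (2) (n/e / p) = 1 for every prime p dividing e with p ≡ 1 (mod 4); (3) (e / p) = 1 for every prime p dividing n/e with p ≡ 1 (mod 4). -/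
noncomputable section

/-- The curve `C'_e : e·w² = e²t⁴ - n²z⁴` is S-locally solvable: it has a real point and a
`ℚ_p`-point with `(t,z) ≠ (0,0)` for every prime `p ∣ 2n`. -/
def SLocSolvC' (n : ℕ) (e : ℤ) : Prop :=
  (∃ w t z : ℝ, (t, z) ≠ (0, 0) ∧
      (e : ℝ) * w ^ 2 = (e : ℝ) ^ 2 * t ^ 4 - (n : ℝ) ^ 2 * z ^ 4) ∧
  ∀ (p : ℕ) [Fact p.Prime], p ∣ 2 * n → ∃ w t z : ℚ_[p], (t, z) ≠ (0, 0) ∧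
      (e : ℚ_[p]) * w ^ 2 = (e : ℚ_[p]) ^ 2 * t ^ 4 - (n : ℚ_[p]) ^ 2 * z ^ 4

/-- A square modulo `p`, up to sign, is detected by the Jacobi symbol only when `p ≡ 1 mod 4`. -/
theorem isSquare_or_isSquare_neg_iff {p : ℕ} [hp : Fact p.Prime] (hp2 : p ≠ 2) {a : ℤ}
    (ha : ¬ (p : ℤ) ∣ a) :
    (IsSquare (a : ZMod p) ∨ IsSquare (-a : ZMod p)) ↔ (p % 4 = 1 → jacobiSym a p = 1) := by
  have ha0 : (a : ZMod p) ≠ 0 := fun h => ha ((ZMod.intCast_zmod_eq_zero_iff_dvd a p).1 h)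
  have hna0 : ((-a : ℤ) : ZMod p) ≠ 0 := by simpa using ha0
  rw [← jacobiSym.legendreSym.to_jacobiSym]
  have h1 := legendreSym.eq_one_iff p ha0
  have h2 := legendreSym.eq_one_iff p hna0
  have h3 := legendreSym.at_neg hp2 a
  have h4 := legendreSym.eq_one_or_neg_one p ha0
  push_cast at h2
  rw [← h1, ← h2, h3]
  have hodd : p % 2 = 1 := hp.out.eq_two_or_odd.resolve_left hp2
  rcases (by omega : p % 4 = 1 ∨ p % 4 = 3) with h | h
  · rw [ZMod.χ₄_nat_one_mod_four h]; simp [h]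
  · rw [ZMod.χ₄_nat_three_mod_four h]
    rcases h4 with h4 | h4 <;> simp [h, h4]

/-- Hensel's lemma for square roots. -/
theorem PadicInt.isSquare_of_norm_sub_lt {p : ℕ} [Fact p.Prime] (a b : ℤ_[p])
    (h : ‖b ^ 2 - a‖ < ‖2 * b‖ ^ 2) : IsSquare a := by
  have key := hensels_lemma (p := p) (R := ℤ_[p]) (F := Polynomial.X ^ 2 - Polynomial.C a) (a := b)
    (by simpa [one_add_one_eq_two] using h)
  obtain ⟨z, hz, -⟩ := key
  refine ⟨z, ?_⟩
  simp only [map_sub, map_pow, Polynomial.aeval_X, Polynomial.aeval_C, Algebra.algebraMap_self,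
    RingHom.id_apply] at hz
  linear_combination -hz

theorem Padic.isSquare_intCast_of_zmod {p : ℕ} [hp : Fact p.Prime] (hp2 : p ≠ 2) {a : ℤ}
    (ha : ¬ (p : ℤ) ∣ a) (h : IsSquare (a : ZMod p)) : IsSquare (a : ℚ_[p]) := by
  obtain ⟨b, hb⟩ := h
  obtain ⟨b, rfl⟩ := ZMod.intCast_surjective b
  have hdvd : (p : ℤ) ∣ b ^ 2 - a := by
    rw [← ZMod.intCast_zmod_eq_zero_iff_dvd]
    push_cast
    linear_combination -hb
  have hpZ : Prime (p : ℤ) := Nat.prime_iff_prime_int.1 hp.out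
  have h2b : ¬ (p : ℤ) ∣ 2 * b := by
    intro h
    rcases hpZ.dvd_or_dvd h with h | h
    · have := (Nat.prime_dvd_prime_iff_eq hp.out Nat.prime_two).1 (by exact_mod_cast h)
      exact hp2 this
    · exact ha ((dvd_sub_right (dvd_pow h two_ne_zero)).1 hdvd)
  have hs : IsSquare (a : ℤ_[p]) := by
    apply PadicInt.isSquare_of_norm_sub_lt _ (b : ℤ_[p])
    have e1 : ‖(2 * b : ℤ_[p])‖ = 1 := by
      have := (PadicInt.norm_int_lt_one_iff_dvd (p := p) (2 * b)).not.2 h2b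
      push_cast at this
      exact le_antisymm (PadicInt.norm_le_one _) (not_lt.1 this)
    have e2 := (PadicInt.norm_int_lt_one_iff_dvd (p := p) (b ^ 2 - a)).2 hdvd
    push_cast at e2
    rw [e1]
    simpa using e2
  simpa using hs.map (PadicInt.Coe.ringHom (p := p))

theorem Padic.isSquare_intCast_of_mod_eight {a : ℤ} (h : a % 8 = 1) : IsSquare (a : ℚ_[2]) := by
  have hs : IsSquare (a : ℤ_[2]) := by
    apply PadicInt.isSquare_of_norm_sub_lt _ (1 : ℤ_[2])
    have h8 : ((2 : ℕ) ^ 3 : ℤ) ∣ 1 - a := by push_cast; omega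
    have e2 := (PadicInt.norm_int_le_pow_iff_dvd (p := 2)).2 h8
    have e3 : ‖(2 : ℤ_[2])‖ = 2⁻¹ := by simpa using PadicInt.norm_p (p := 2)
    push_cast at e2
    rw [mul_one, e3, one_pow]
    refine e2.trans_lt ?_
    norm_num
  simpa using hs.map (PadicInt.Coe.ringHom (p := 2))

/-- A `p`-adic point on `w² = a t⁴ + b z⁴` can be made integral, with `t = 1` or `z = 1`. -/
theorem Padic.exists_integral_point {p : ℕ} [Fact p.Prime] (a b : ℤ)
    (h : ∃ w t z : ℚ_[p], (t, z) ≠ (0, 0) ∧ w ^ 2 = a * t ^ 4 + b * z ^ 4) :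
    ∃ w x : ℤ_[p], w ^ 2 = a + b * x ^ 4 ∨ w ^ 2 = a * x ^ 4 + b := by
  have integral (w : ℚ_[p]) (y : ℤ_[p]) (hw : w ^ 2 = y) : ∃ w' : ℤ_[p], w' ^ 2 = y := by
    have hn : ‖w‖ ≤ 1 := by
      have : ‖w‖ ^ 2 ≤ 1 := by
        rw [← norm_pow, hw]
        exact PadicInt.norm_le_one y
      exact (sq_le_one_iff₀ (norm_nonneg _)).1 this
    exact ⟨⟨w, hn⟩, Subtype.ext (by rw [← hw]; rfl)⟩
  obtain ⟨w, t, z, h0, h⟩ := h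
  rcases le_total ‖z‖ ‖t‖ with hle | hle
  · have ht : t ≠ 0 := by
      rintro rfl
      exact h0 (by simpa using hle)
    have hx : ‖z / t‖ ≤ 1 := by
      rw [norm_div]; exact div_le_one_of_le₀ hle (norm_nonneg _)
    obtain ⟨y, hy⟩ : ∃ y : ℤ_[p], (y : ℚ_[p]) = z / t := ⟨⟨_, hx⟩, rfl⟩
    obtain ⟨w', hw'⟩ := integral (w / t ^ 2) (a + b * y ^ 4) (by
      push_cast
      rw [hy]
      field_simp
      linear_combination h)
    exact ⟨w', _, Or.inl hw'⟩
  · have hz : z ≠ 0 := by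
      rintro rfl
      exact h0 (by simpa using hle)
    have hx : ‖t / z‖ ≤ 1 := by
      rw [norm_div]; exact div_le_one_of_le₀ hle (norm_nonneg _)
    obtain ⟨y, hy⟩ : ∃ y : ℤ_[p], (y : ℚ_[p]) = t / z := ⟨⟨_, hx⟩, rfl⟩
    obtain ⟨w', hw'⟩ := integral (w / z ^ 2) (a * y ^ 4 + b) (by
      push_cast
      rw [hy]
      field_simp
      linear_combination h)
    exact ⟨w', _, Or.inr hw'⟩

theorem not_two_adic_point_of_even {n : ℕ} (hn : Odd n) {e : ℤ} (he : e % 4 = 2) :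
    ¬ ∃ w t z : ℚ_[2], (t, z) ≠ (0, 0) ∧
      (e : ℚ_[2]) * w ^ 2 = (e : ℚ_[2]) ^ 2 * t ^ 4 - (n : ℚ_[2]) ^ 2 * z ^ 4 := by
  rintro ⟨w, t, z, h0, h⟩
  have hN : ((n : ZMod 16) ^ 2 = 1 ∨ (n : ZMod 16) ^ 2 = 9) := by
    have key : ∀ r : Fin 16, r.val % 2 = 1 →
        ((r.val : ZMod 16) ^ 2 = 1 ∨ (r.val : ZMod 16) ^ 2 = 9) := by
      decide
    have := key ⟨n % 16, by omega⟩ (by have := Nat.odd_iff.1 hn; simp; omega)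
    simpa using this
  have hE : (e : ZMod 16) = 2 ∨ (e : ZMod 16) = 6 ∨ (e : ZMod 16) = 10 ∨ (e : ZMod 16) = 14 := by
    rcases (by omega : e % 16 = 2 ∨ e % 16 = 6 ∨ e % 16 = 10 ∨ e % 16 = 14) with h | h | h | h
    · left; exact (ZMod.intCast_eq_intCast_iff' e 2 16).2 h
    · right; left; exact (ZMod.intCast_eq_intCast_iff' e 6 16).2 h
    · right; right; left; exact (ZMod.intCast_eq_intCast_iff' e 10 16).2 h
    · right; right; right; exact (ZMod.intCast_eq_intCast_iff' e 14 16).2 h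
  obtain ⟨u, x, hu⟩ := Padic.exists_integral_point (p := 2) (e ^ 3) (-(e * n ^ 2))
    ⟨e * w, t, z, h0, by push_cast; linear_combination (e : ℚ_[2]) * h⟩
  have key : ∀ E N : ZMod 16, (N = 1 ∨ N = 9) → (E = 2 ∨ E = 6 ∨ E = 10 ∨ E = 14) →
      ∀ u x : ZMod 16, u ^ 2 ≠ E ^ 3 + -(E * N) * x ^ 4 ∧ u ^ 2 ≠ E ^ 3 * x ^ 4 + -(E * N) := by
    rintro E N (rfl | rfl) (rfl | rfl | rfl | rfl) <;> decide
  have := key _ _ hN hE (PadicInt.toZModPow (p := 2) 4 u) (PadicInt.toZModPow (p := 2) 4 x)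
  rcases hu with hu | hu
  · exact this.1 (by simpa using congrArg (PadicInt.toZModPow (p := 2) 4) hu)
  · exact this.2 (by simpa using congrArg (PadicInt.toZModPow (p := 2) 4) hu)

theorem two_adic_point_iff {e m : ℤ} (he : Odd e) (hm : Odd m) :
    (∃ w t z : ℚ_[2], (t, z) ≠ (0, 0) ∧ w ^ 2 = e * (t ^ 4 - m ^ 2 * z ^ 4)) ↔
      (e % 8 = 1 ∨ e % 8 = 7 ∨ m % 8 = 1 ∨ m % 8 = 7) := by
  constructor
  · rintro ⟨w, t, z, h0, h⟩
    by_contra hcon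
    have he' := Int.odd_iff.1 he
    have hm' := Int.odd_iff.1 hm
    have cast3 : ∀ a : ℤ, a % 8 = 3 ∨ a % 8 = 5 →
        (a : ZMod 16) = 3 ∨ (a : ZMod 16) = 5 ∨ (a : ZMod 16) = 11 ∨ (a : ZMod 16) = 13 := by
      intro a ha
      rcases (by omega : a % 16 = 3 ∨ a % 16 = 5 ∨ a % 16 = 11 ∨ a % 16 = 13) with h | h | h | h
      · left; exact (ZMod.intCast_eq_intCast_iff' a 3 16).2 h
      · right; left; exact (ZMod.intCast_eq_intCast_iff' a 5 16).2 h
      · right; right; left; exact (ZMod.intCast_eq_intCast_iff' a 11 16).2 h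
      · right; right; right; exact (ZMod.intCast_eq_intCast_iff' a 13 16).2 h
    have hE := cast3 e (by omega)
    have hM : (m : ZMod 16) ^ 2 = 9 := by
      rcases cast3 m (by omega) with h | h | h | h <;> rw [h] <;> decide
    obtain ⟨u, x, hu⟩ := Padic.exists_integral_point (p := 2) e (-(e * m ^ 2))
      ⟨w, t, z, h0, by push_cast; linear_combination h⟩
    have key : ∀ E : ZMod 16, (E = 3 ∨ E = 5 ∨ E = 11 ∨ E = 13) →
        ∀ u x : ZMod 16, u ^ 2 ≠ E + -(E * 9) * x ^ 4 ∧ u ^ 2 ≠ E * x ^ 4 + -(E * 9) := by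
      rintro E (rfl | rfl | rfl | rfl) <;> decide
    have := key _ hE (PadicInt.toZModPow (p := 2) 4 u) (PadicInt.toZModPow (p := 2) 4 x)
    rw [← hM] at this
    rcases hu with hu | hu
    · exact this.1 (by simpa using congrArg (PadicInt.toZModPow (p := 2) 4) hu)
    · exact this.2 (by simpa using congrArg (PadicInt.toZModPow (p := 2) 4) hu)
  · rintro (h | h | h | h)
    · obtain ⟨r, hr⟩ := Padic.isSquare_intCast_of_mod_eight h
      exact ⟨r, 1, 0, by simp, by linear_combination -hr⟩
    · obtain ⟨r, hr⟩ := Padic.isSquare_intCast_of_mod_eight (a := -e) (by omega)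
      push_cast at hr
      exact ⟨r * m, 0, 1, by simp, by linear_combination -(m : ℚ_[2]) ^ 2 * hr⟩
    · obtain ⟨r, hr⟩ := Padic.isSquare_intCast_of_mod_eight h
      exact ⟨0, r, 1, by simp, by rw [hr]; ring⟩
    · obtain ⟨r, hr⟩ := Padic.isSquare_intCast_of_mod_eight (a := -m) (by omega)
      push_cast at hr
      exact ⟨0, r, 1, by simp, by
        linear_combination (e : ℚ_[2]) * (r ^ 2 - m) * hr⟩

theorem padic_point_iff_of_dvd_left {p : ℕ} [hp : Fact p.Prime] (hp2 : p ≠ 2) {e m : ℤ}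
    (hpe : (p : ℤ) ∣ e) (he : Squarefree e) (hpm : ¬ (p : ℤ) ∣ m) :
    (∃ w t z : ℚ_[p], (t, z) ≠ (0, 0) ∧ w ^ 2 = e * (t ^ 4 - m ^ 2 * z ^ 4)) ↔
      (p % 4 = 1 → jacobiSym m p = 1) := by
  rw [← isSquare_or_isSquare_neg_iff hp2 hpm]
  have hpZ : Prime (p : ℤ) := Nat.prime_iff_prime_int.1 hp.out
  have hm0 : (m : ZMod p) ≠ 0 := fun h => hpm ((ZMod.intCast_zmod_eq_zero_iff_dvd m p).1 h)
  constructor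
  · rintro ⟨w, t, z, h0, h⟩
    obtain ⟨u, x, hu⟩ := Padic.exists_integral_point (p := p) e (-(e * m ^ 2))
      ⟨w, t, z, h0, by push_cast; linear_combination h⟩
    obtain ⟨f, rfl⟩ := hpe
    have hf0 : (f : ZMod p) ≠ 0 := fun h => by
      have hpf := (ZMod.intCast_zmod_eq_zero_iff_dvd f p).1 h
      exact hpZ.not_isUnit (he _ (mul_dvd_mul_left _ hpf))
    have descend : ∀ y : ℤ_[p], u ^ 2 = ((p * f : ℤ) : ℤ_[p]) * y → PadicInt.toZMod y = 0 := by
      intro y hy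
      push_cast at hy
      have hpu : (p : ℤ_[p]) ∣ u :=
        PadicInt.prime_p.dvd_of_dvd_pow (n := 2) ⟨f * y, by rw [hy]; ring⟩
      obtain ⟨v, rfl⟩ := hpu
      have h1 : (f : ℤ_[p]) * y = p * v ^ 2 :=
        mul_left_cancel₀ PadicInt.prime_p.ne_zero (by linear_combination -hy)
      have h2 := congrArg (PadicInt.toZMod (p := p)) h1
      simpa [hf0] using h2
    rcases hu with hu | hu
    · have h := descend (1 - m ^ 2 * x ^ 4) (by rw [hu]; push_cast; ring)
      simp only [map_sub, map_one, map_mul, map_pow, map_intCast] at h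
      set y := PadicInt.toZMod x
      have hy : y ≠ 0 := by
        intro hy
        simp [hy] at h
      have : (1 - m * y ^ 2) * (1 + m * y ^ 2) = 0 := by linear_combination h
      rcases mul_eq_zero.1 this with h | h
      · left; exact ⟨y⁻¹, by field_simp; linear_combination -h⟩
      · right; exact ⟨y⁻¹, by field_simp; linear_combination -h⟩
    · have h := descend (x ^ 4 - m ^ 2) (by rw [hu]; push_cast; ring)
      simp only [map_sub, map_pow, map_intCast] at h
      set y := PadicInt.toZMod x
      have : (y ^ 2 - m) * (y ^ 2 + m) = 0 := by linear_combination h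
      rcases mul_eq_zero.1 this with h | h
      · left; exact ⟨y, by linear_combination -h⟩
      · right; exact ⟨y, by linear_combination -h⟩
  · rintro (h | h)
    · obtain ⟨r, hr⟩ := Padic.isSquare_intCast_of_zmod hp2 hpm h
      exact ⟨0, r, 1, by simp, by rw [hr]; ring⟩
    · obtain ⟨r, hr⟩ := Padic.isSquare_intCast_of_zmod (a := -m) hp2 (by simpa using hpm)
        (by simpa using h)
      push_cast at hr
      exact ⟨0, r, 1, by simp, by linear_combination (e : ℚ_[p]) * (r ^ 2 - m) * hr⟩

theorem padic_point_iff_of_dvd_right {p : ℕ} [hp : Fact p.Prime] (hp2 : p ≠ 2) {e m : ℤ}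
    (hpm : (p : ℤ) ∣ m) (hm : Squarefree m) (hpe : ¬ (p : ℤ) ∣ e) :
    (∃ w t z : ℚ_[p], (t, z) ≠ (0, 0) ∧ w ^ 2 = e * (t ^ 4 - m ^ 2 * z ^ 4)) ↔
      (p % 4 = 1 → jacobiSym e p = 1) := by
  rw [← isSquare_or_isSquare_neg_iff hp2 hpe]
  have hpZ : Prime (p : ℤ) := Nat.prime_iff_prime_int.1 hp.out
  constructor
  · rintro ⟨w, t, z, h0, h⟩
    obtain ⟨u, x, hu⟩ := Padic.exists_integral_point (p := p) e (-(e * m ^ 2))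
      ⟨w, t, z, h0, by push_cast; linear_combination h⟩
    obtain ⟨k, rfl⟩ := hpm
    have hk0 : (k : ZMod p) ≠ 0 := fun h => by
      have hpk := (ZMod.intCast_zmod_eq_zero_iff_dvd k p).1 h
      exact hpZ.not_isUnit (hm _ (mul_dvd_mul_left _ hpk))
    rcases hu with hu | hu
    · have h := congrArg (PadicInt.toZMod (p := p)) hu
      left
      exact ⟨PadicInt.toZMod u, by rw [← sq]; simpa using h.symm⟩
    · by_cases hx : (p : ℤ_[p]) ∣ x
      · obtain ⟨y, rfl⟩ := hx
        push_cast at hu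
        have hpu : (p : ℤ_[p]) ∣ u := PadicInt.prime_p.dvd_of_dvd_pow (n := 2)
          ⟨e * p ^ 3 * y ^ 4 - e * p * k ^ 2, by rw [hu]; ring⟩
        obtain ⟨v, rfl⟩ := hpu
        have h1 : v ^ 2 = e * p ^ 2 * y ^ 4 - e * k ^ 2 :=
          mul_left_cancel₀ (pow_ne_zero 2 PadicInt.prime_p.ne_zero) (by linear_combination hu)
        have h2 := congrArg (PadicInt.toZMod (p := p)) h1
        simp only [map_sub, map_mul, map_pow, map_natCast, map_intCast, CharP.cast_eq_zero] at h2
        right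
        exact ⟨PadicInt.toZMod v / k, by field_simp; linear_combination -h2⟩
      · have hx0 : PadicInt.toZMod x ≠ 0 := by
          intro h
          apply hx
          rw [← PadicInt.norm_lt_one_iff_dvd, ← PadicInt.mem_nonunits]
          change x ∈ IsLocalRing.maximalIdeal ℤ_[p]
          rw [← PadicInt.ker_toZMod]
          exact h
        have h := congrArg (PadicInt.toZMod (p := p)) hu
        simp only [map_add, map_neg, map_mul, map_pow, map_intCast, Int.cast_neg, Int.cast_mul,
          Int.cast_natCast, Int.cast_pow, map_natCast, CharP.cast_eq_zero] at h
        left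
        exact ⟨PadicInt.toZMod u / PadicInt.toZMod x ^ 2, by field_simp; linear_combination -h⟩
  · rintro (h | h)
    · obtain ⟨r, hr⟩ := Padic.isSquare_intCast_of_zmod hp2 hpe h
      exact ⟨r, 1, 0, by simp, by linear_combination -hr⟩
    · obtain ⟨r, hr⟩ := Padic.isSquare_intCast_of_zmod (a := -e) hp2 (by simpa using hpe)
        (by simpa using h)
      push_cast at hr
      exact ⟨r * m, 0, 1, by simp, by linear_combination -(m : ℚ_[p]) ^ 2 * hr⟩

theorem exists_real_point (n : ℕ) {e : ℤ} (he : e ≠ 0) : ∃ w t z : ℝ, (t, z) ≠ (0, 0) ∧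
    (e : ℝ) * w ^ 2 = (e : ℝ) ^ 2 * t ^ 4 - (n : ℝ) ^ 2 * z ^ 4 := by
  rcases lt_or_gt_of_ne he with h | h
  · have h' : (e : ℝ) < 0 := by exact_mod_cast h
    refine ⟨n / √(-e), 0, 1, by simp, ?_⟩
    rw [div_pow, Real.sq_sqrt (by linarith)]
    field_simp
    ring
  · have h' : (0 : ℝ) ≤ e := by exact_mod_cast h.le
    refine ⟨√e, 1, 0, by simp, ?_⟩
    rw [Real.sq_sqrt h']
    ring

/-- Local solvability of `C'_e : e·w² = e²t⁴ - n²z⁴` for a squarefree divisor `e` of `2n`. -/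
theorem sLocSolvC'_iff
    (n : ℕ) (hodd : Odd n) (hpos : 0 < n) (hsf : Squarefree n)
    (e : ℤ) (hesf : Squarefree e) (hediv : e ∣ 2 * n) :
    SLocSolvC' n e ↔
      (Odd e ∧ (e % 8 = 1 ∨ e % 8 = 7 ∨ (n : ℤ) / e % 8 = 1 ∨ (n : ℤ) / e % 8 = 7)) ∧
      (∀ p : ℕ, p.Prime → (p : ℤ) ∣ e → p % 4 = 1 → jacobiSym ((n : ℤ) / e) p = 1) ∧
      (∀ p : ℕ, p.Prime → (p : ℤ) ∣ ((n : ℤ) / e) → p % 4 = 1 → jacobiSym e p = 1) := by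
  have he0 : e ≠ 0 := hesf.ne_zero
  rcases Int.even_or_odd e with heven | heodd
  · have he4 : e % 4 = 2 := by
      have h2 := Int.even_iff.1 heven
      by_contra hne
      have h4 : (2 : ℤ) * 2 ∣ e := by omega
      exact absurd (hesf 2 h4) (by decide)
    refine iff_of_false (fun h => ?_) (fun h => Int.not_even_iff_odd.2 h.1.1 heven)
    exact not_two_adic_point_of_even hodd he4 (h.2 2 (dvd_mul_right 2 n))
  have hen : e ∣ (n : ℤ) :=
    (Int.isCoprime_two_right.2 heodd).dvd_of_dvd_mul_left hediv
  obtain ⟨m, hm⟩ := hen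
  have hdiv : (n : ℤ) / e = m := by rw [hm, Int.mul_ediv_cancel_left _ he0]
  rw [hdiv]
  have hsfem : Squarefree (e * m) := by
    rw [← hm]
    exact Int.squarefree_natCast.2 hsf
  have hmsf : Squarefree m := hsfem.squarefree_of_dvd (dvd_mul_left m e)
  have hmodd : Odd m := by
    have : Odd (e * m) := by rw [← hm]; exact_mod_cast hodd
    exact (Int.odd_mul.1 this).2
  have hcurve (p : ℕ) [Fact p.Prime] : (∃ w t z : ℚ_[p], (t, z) ≠ (0, 0) ∧
      (e : ℚ_[p]) * w ^ 2 = (e : ℚ_[p]) ^ 2 * t ^ 4 - (n : ℚ_[p]) ^ 2 * z ^ 4) ↔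
      ∃ w t z : ℚ_[p], (t, z) ≠ (0, 0) ∧ w ^ 2 = e * (t ^ 4 - m ^ 2 * z ^ 4) := by
    have hn : (n : ℚ_[p]) = e * m := by exact_mod_cast congrArg (Int.cast (R := ℚ_[p])) hm
    have he : (e : ℚ_[p]) ≠ 0 := by exact_mod_cast he0
    refine exists_congr fun w => exists_congr fun t => exists_congr fun z =>
      and_congr_right fun _ => ?_
    rw [hn]
    constructor
    · intro h
      exact mul_left_cancel₀ he (by linear_combination h)
    · intro h
      linear_combination (e : ℚ_[p]) * h
  have not_both (p : ℕ) (hp : p.Prime) (h1 : (p : ℤ) ∣ e) : ¬ (p : ℤ) ∣ m := fun h2 =>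
    (Nat.prime_iff_prime_int.1 hp).not_isUnit (hsfem _ (mul_dvd_mul h1 h2))
  have ne_two (p : ℕ) (hp : (p : ℤ) ∣ n) : p ≠ 2 := by
    rintro rfl
    have := Nat.odd_iff.1 hodd
    omega
  constructor
  · rintro ⟨-, h⟩
    refine ⟨⟨heodd, ?_⟩, fun p hp hpe => ?_, fun p hp hpm => ?_⟩
    · exact (two_adic_point_iff heodd hmodd).1 ((hcurve 2).1 (h 2 (dvd_mul_right 2 n)))
    · have := Fact.mk hp
      have hpn : (p : ℤ) ∣ n := hm ▸ hpe.mul_right m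
      exact (padic_point_iff_of_dvd_left (ne_two p hpn) hpe hesf (not_both p hp hpe)).1
        ((hcurve p).1 (h p (dvd_mul_of_dvd_right (by exact_mod_cast hpn) 2)))
    · have := Fact.mk hp
      have hpn : (p : ℤ) ∣ n := hm ▸ hpm.mul_left e
      exact (padic_point_iff_of_dvd_right (ne_two p hpn) hpm hmsf
        (fun hpe => not_both p hp hpe hpm)).1
        ((hcurve p).1 (h p (dvd_mul_of_dvd_right (by exact_mod_cast hpn) 2)))
  · rintro ⟨⟨-, h2⟩, he, hm'⟩
    refine ⟨exists_real_point n he0, fun p hp hpn => (hcurve p).2 ?_⟩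
    by_cases hp2 : p = 2
    · subst hp2
      exact (two_adic_point_iff heodd hmodd).2 h2
    have hpn' : (p : ℤ) ∣ e * m := by
      rw [← hm]
      refine Int.natCast_dvd_natCast.2 ((hp.out.dvd_mul.1 hpn).resolve_left fun h => hp2 ?_)
      exact (Nat.prime_dvd_prime_iff_eq hp.out Nat.prime_two).1 h
    rcases (Nat.prime_iff_prime_int.1 hp.out).dvd_or_dvd hpn' with hpe | hpm
    · exact (padic_point_iff_of_dvd_left hp2 hpe hesf (not_both p hp.out hpe)).2
        (he p hp.out hpe)
    · exact (padic_point_iff_of_dvd_right hp2 hpm hmsf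
        (fun hpe => not_both p hp.out hpe hpm)).2 (hm' p hp.out hpm)

end
end

section
/- Let n be an odd integer and e a nonzero even squarefree integer. Then the equation e·w² = e²t⁴ − n²z⁴ has no solution (w,t,z) ∈ ℚ₂³ with (t,z) ≠ (0,0). -/
noncomputable section

theorem Padic.valuation_eq_of_norm_eq {p : ℕ} [Fact p.Prime] {x y : ℚ_[p]} (h : ‖x‖ = ‖y‖) :
    x.valuation = y.valuation := by
  by_cases hx : x = 0
  · have hy : y = 0 := by rwa [hx, norm_zero, eq_comm, norm_eq_zero] at h
    rw [hx, hy]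
  have hy : y ≠ 0 := by rwa [← norm_ne_zero_iff, ← h, norm_ne_zero_iff]
  have hp : (1 : ℝ) < p := by exact_mod_cast (Fact.out : p.Prime).one_lt
  rw [Padic.norm_eq_zpow_neg_valuation hx, Padic.norm_eq_zpow_neg_valuation hy] at h
  exact neg_injective (zpow_right_injective₀ (by positivity) hp.ne' h)

theorem Padic.valuation_intCast_of_odd {n : ℤ} (hn : Odd n) : (n : ℚ_[2]).valuation = 0 := by
  rw [Padic.valuation_intCast, padicValInt.eq_zero_of_not_dvd, Nat.cast_zero]
  exact_mod_cast fun h : (2 : ℤ) ∣ n => Int.not_even_iff_odd.mpr hn (even_iff_two_dvd.mpr h)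

theorem Padic.valuation_intCast_of_even_of_squarefree {e : ℤ} (he : Even e)
    (hesf : Squarefree e) : (e : ℚ_[2]).valuation = 1 := by
  obtain ⟨k, rfl⟩ := even_iff_two_dvd.mp he
  have hk : Odd k := by
    rw [← Int.not_even_iff_odd, even_iff_two_dvd]
    intro h
    have := Int.isUnit_iff.mp (hesf 2 (mul_dvd_mul_left 2 h))
    lia
  have hk0 : (k : ℚ_[2]) ≠ 0 := by
    rintro h
    rw [Int.cast_eq_zero.mp h] at hk
    simp at hk
  have h2 : (2 : ℚ_[2]).valuation = 1 := by exact_mod_cast Padic.valuation_p (p := 2)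
  rw [Int.cast_mul, Int.cast_ofNat, Padic.valuation_mul two_ne_zero hk0, h2,
    Padic.valuation_intCast_of_odd hk, add_zero]

/-- For odd `n` and nonzero even squarefree `e`, the equation `e·w² = e²t⁴ - n²z⁴` has no
nontrivial `ℚ₂`-point. -/
theorem qtwo_not_solvable (n e : ℤ) (hn : Odd n) (he : Even e) (he0 : e ≠ 0)
    (hesf : Squarefree e) :
    ¬ ∃ w t z : ℚ_[2], (t, z) ≠ (0, 0) ∧
      (e : ℚ_[2]) * w ^ 2 = (e : ℚ_[2]) ^ 2 * t ^ 4 - (n : ℚ_[2]) ^ 2 * z ^ 4 := by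
  rintro ⟨w, t, z, htz, h⟩
  have hn0 : (n : ℚ_[2]) ≠ 0 := by
    intro h0
    rw [Int.cast_eq_zero.mp h0] at hn
    simp at hn
  have he0' : (e : ℚ_[2]) ≠ 0 := Int.cast_ne_zero.mpr he0
  have hve := Padic.valuation_intCast_of_even_of_squarefree he hesf
  have hvn := Padic.valuation_intCast_of_odd hn
  have hvw (hw : w ≠ 0) : ((e : ℚ_[2]) * w ^ 2).valuation = 1 + 2 * w.valuation := by
    rw [Padic.valuation_mul he0' (pow_ne_zero _ hw), Padic.valuation_pow, hve]; rfl
  have hvt (ht : t ≠ 0) : ((e : ℚ_[2]) ^ 2 * t ^ 4).valuation = 2 + 4 * t.valuation := by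
    rw [Padic.valuation_mul (pow_ne_zero _ he0') (pow_ne_zero _ ht), Padic.valuation_pow,
      Padic.valuation_pow, hve]; rfl
  have hvz (hz : z ≠ 0) : ((n : ℚ_[2]) ^ 2 * z ^ 4).valuation = 4 * z.valuation := by
    rw [Padic.valuation_mul (pow_ne_zero _ hn0) (pow_ne_zero _ hz), Padic.valuation_pow,
      Padic.valuation_pow, hvn, mul_zero, zero_add]; rfl
  have hne_t (ht : t ≠ 0) : ‖(e : ℚ_[2]) * w ^ 2‖ ≠ ‖(e : ℚ_[2]) ^ 2 * t ^ 4‖ := by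
    intro heq
    have hw : w ≠ 0 := by
      rintro rfl
      simp [he0', ht, eq_comm] at heq
    have := Padic.valuation_eq_of_norm_eq heq
    rw [hvw hw, hvt ht] at this
    lia
  have hne_z (hz : z ≠ 0) : ‖(e : ℚ_[2]) * w ^ 2‖ ≠ ‖(n : ℚ_[2]) ^ 2 * z ^ 4‖ := by
    intro heq
    have hw : w ≠ 0 := by
      rintro rfl
      simp [hn0, hz, eq_comm] at heq
    have := Padic.valuation_eq_of_norm_eq heq
    rw [hvw hw, hvz hz] at this
    lia
  by_cases ht : t = 0
  · have hz : z ≠ 0 := fun hz => htz (by rw [ht, hz])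
    exact hne_z hz (by rw [h, ht]; simp)
  by_cases hz : z = 0
  · exact hne_t ht (by rw [h, hz]; simp)
  have hne : ‖(e : ℚ_[2]) ^ 2 * t ^ 4‖ ≠ ‖-((n : ℚ_[2]) ^ 2 * z ^ 4)‖ := by
    rw [norm_neg]
    intro heq
    have := Padic.valuation_eq_of_norm_eq heq
    rw [hvt ht, hvz hz] at this
    lia
  have hmax := Padic.add_eq_max_of_ne hne
  rw [← sub_eq_add_neg, ← h, norm_neg] at hmax
  rcases max_choice ‖(e : ℚ_[2]) ^ 2 * t ^ 4‖ ‖(n : ℚ_[2]) ^ 2 * z ^ 4‖ with hm | hm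
  · exact hne_t ht (hmax.trans hm)
  · exact hne_z hz (hmax.trans hm)

end
end

section
/- Let n be a squarefree positive integer with n ≡ 1 (mod 8) all of whose prime factors are ≡ 1 (mod 4), and let d be a (possibly negative) divisor of n. Then the curve C_{2d} : 2d·w² = 4d²t⁴ + 4n²z⁴ is S-locally solvable if and only if d > 0, the Legendre symbol (2n/d / p) = 1 for every prime p dividing d, and (2d / p) = 1 for every prime p dividing n/d. -/
noncomputable section

namespace PadicInt

/-- Square roots by Hensel lifting. -/
theorem isSquare_of_norm_sq_sub_lt {p : ℕ} [Fact p.Prime] {a b : ℤ_[p]}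
    (h : ‖b ^ 2 - a‖ < ‖2 * b‖ ^ 2) : IsSquare a := by
  obtain ⟨z, hz, -⟩ := hensels_lemma (p := p)
    (F := (Polynomial.X ^ 2 - Polynomial.C a : Polynomial ℤ_[p])) (a := b) (by
      simpa [Polynomial.derivative_X_pow, one_add_one_eq_two] using h)
  refine ⟨z, ?_⟩
  have : z ^ 2 - a = 0 := by simpa using hz
  linear_combination -this

theorem isSquare_of_norm_sq_sub_lt_one {p : ℕ} [Fact p.Prime] (hp : p ≠ 2) {a b : ℤ_[p]}
    (hb : ‖b‖ = 1) (h : ‖b ^ 2 - a‖ < 1) : IsSquare a := by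
  have h2 : ‖(2 : ℤ_[p])‖ = 1 := by
    have : IsCoprime ((2 : ℤ)) (p : ℤ) := by
      refine (Nat.isCoprime_iff_coprime (m := 2)).2 ?_
      exact (Nat.coprime_primes Nat.prime_two Fact.out).2 hp.symm
    simpa using norm_intCast_eq_one_iff.2 this
  exact isSquare_of_norm_sq_sub_lt (b := b) (by simpa [h2, hb] using h)

end PadicInt

namespace Padic

variable {p : ℕ} [Fact p.Prime]

theorem isSquare_of_norm_sub_one_lt_one (hp : p ≠ 2) {u : ℚ_[p]} (h : ‖u - 1‖ < 1) :
    IsSquare u := by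
  have hu : ‖u‖ ≤ 1 := by
    have := Padic.nonarchimedean (u - 1) 1
    simpa [h.le] using this
  obtain ⟨v, rfl⟩ : ∃ v : ℤ_[p], (v : ℚ_[p]) = u := ⟨⟨u, hu⟩, rfl⟩
  have : IsSquare v := PadicInt.isSquare_of_norm_sq_sub_lt_one hp (b := 1) (by simp) (by
    rw [norm_sub_rev]
    simpa [PadicInt.norm_def] using h)
  exact this.map PadicInt.Coe.ringHom

theorem isSquare_intCast_iff_s10 (hp : p ≠ 2) {k : ℤ} (hk : ¬ (p : ℤ) ∣ k) :
    IsSquare (k : ℚ_[p]) ↔ IsSquare (k : ZMod p) := by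
  constructor
  · rintro ⟨s, hs⟩
    have hs1 : ‖s‖ ≤ 1 := by
      have : ‖s‖ * ‖s‖ ≤ 1 := by
        rw [← norm_mul, ← hs]
        exact Padic.norm_int_le_one k
      nlinarith [norm_nonneg s]
    obtain ⟨v, rfl⟩ : ∃ v : ℤ_[p], (v : ℚ_[p]) = s := ⟨⟨s, hs1⟩, rfl⟩
    have : IsSquare (k : ℤ_[p]) := ⟨v, PadicInt.ext (by simpa using hs)⟩
    simpa using this.map PadicInt.toZMod
  · rintro ⟨x, hx⟩
    have h1 : (p : ℤ) ∣ (x.val : ℤ) ^ 2 - k := by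
      rw [← ZMod.intCast_zmod_eq_zero_iff_dvd]
      simp [hx, pow_two]
    have h2 : ¬ (p : ℤ) ∣ (x.val : ℤ) := fun h => hk (by
      have := dvd_sub (dvd_pow h two_ne_zero) h1
      simpa using this)
    have : IsSquare (k : ℤ_[p]) :=
      PadicInt.isSquare_of_norm_sq_sub_lt_one hp (b := ((x.val : ℤ) : ℤ_[p]))
        (le_antisymm (PadicInt.norm_le_one _)
          (not_lt.1 fun h => h2 (PadicInt.norm_intCast_lt_one_iff.1 h)))
        (by
          have := PadicInt.norm_intCast_lt_one_iff.2 h1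
          push_cast at this ⊢
          exact this)
    simpa using this.map PadicInt.Coe.ringHom

theorem jacobiSym_eq_one_iff_isSquare (hp : p ≠ 2) {k : ℤ} (hk : ¬ (p : ℤ) ∣ k) :
    jacobiSym k p = 1 ↔ IsSquare (k : ℚ_[p]) := by
  rw [isSquare_intCast_iff_s10 hp hk, ← jacobiSym.legendreSym.to_jacobiSym, legendreSym.eq_one_iff]
  rwa [Ne, ZMod.intCast_zmod_eq_zero_iff_dvd]

theorem exists_sq_eq_neg_one (hp : p % 4 = 1) : ∃ i : ℚ_[p], i ^ 2 = -1 := by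
  have hp2 : p ≠ 2 := by rintro rfl; omega
  have h : ¬ (p : ℤ) ∣ -1 := by
    rw [dvd_neg]
    exact_mod_cast (Fact.out : p.Prime).not_dvd_one
  obtain ⟨i, hi⟩ := (isSquare_intCast_iff_s10 hp2 h).2
    (by simpa using ZMod.exists_sq_eq_neg_one_iff.2 (by omega : p % 4 ≠ 3))
  exact ⟨i, by rw [pow_two, ← hi]; simp⟩

theorem even_valuation_of_isSquare {x : ℚ_[p]} (h : IsSquare x) : Even x.valuation := by
  obtain ⟨s, rfl⟩ := h
  rw [← pow_two, valuation_pow]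
  exact even_two_mul _

theorem norm_ne_of_odd_valuation_of_even {x y : ℚ_[p]} (hx : x ≠ 0) (hy : y ≠ 0)
    (h : Even x.valuation) (h' : Odd y.valuation) : ‖x‖ ≠ ‖y‖ := by
  intro hxy
  rw [norm_eq_zpow_neg_valuation hx, norm_eq_zpow_neg_valuation hy] at hxy
  have hp : 1 < (p : ℝ) := by exact_mod_cast (Fact.out : p.Prime).one_lt
  have := zpow_right_injective₀ (by linarith) hp.ne' hxy
  rw [neg_inj] at this
  rw [this] at h
  exact (Int.not_even_iff_odd.2 h') h

/-- A sum of two squares of distinct absolute values is a nonzero square. -/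
theorem isSquare_sq_add_sq (hp : p ≠ 2) {x y : ℚ_[p]} (h : ‖x‖ ≠ ‖y‖) :
    IsSquare (x ^ 2 + y ^ 2) ∧ x ^ 2 + y ^ 2 ≠ 0 := by
  wlog hlt : ‖y‖ < ‖x‖ generalizing x y
  · rw [add_comm]
    exact this h.symm (lt_of_le_of_ne (not_lt.1 hlt) h)
  have hx : 0 < ‖x‖ := (norm_nonneg y).trans_lt hlt
  have hx0 : x ≠ 0 := norm_pos_iff.1 hx
  have hu : ‖1 + (y / x) ^ 2 - 1‖ < 1 := by
    rw [add_sub_cancel_left, norm_pow, norm_div]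
    exact pow_lt_one₀ (by positivity) ((div_lt_one hx).2 hlt) two_ne_zero
  have he : x ^ 2 + y ^ 2 = x ^ 2 * (1 + (y / x) ^ 2) := by field_simp
  rw [he]
  refine ⟨(IsSquare.sq x).mul (isSquare_of_norm_sub_one_lt_one hp hu),
    mul_ne_zero (pow_ne_zero 2 hx0) fun h0 => ?_⟩
  simp [h0] at hu

theorem isSquare_of_sq_eq_of_odd_valuation (hp : p ≠ 2) {c m w t z : ℚ_[p]} (hm : m ≠ 0)
    (hmv : Odd m.valuation) (htz : (t, z) ≠ (0, 0))
    (h : w ^ 2 = c * (t ^ 4 + m ^ 2 * z ^ 4)) : IsSquare c := by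
  have hne : ‖t ^ 2‖ ≠ ‖m * z ^ 2‖ := by
    by_cases ht : t = 0
    · have hz : z ≠ 0 := fun hz => htz (by rw [ht, hz])
      simp [ht, hm, hz]
    by_cases hz : z = 0
    · simp [ht, hz]
    refine norm_ne_of_odd_valuation_of_even (pow_ne_zero 2 ht)
      (mul_ne_zero hm (pow_ne_zero 2 hz)) (even_valuation_of_isSquare (IsSquare.sq t)) ?_
    rw [valuation_mul hm (pow_ne_zero 2 hz)]
    exact hmv.add_even (even_valuation_of_isSquare (IsSquare.sq z))
  obtain ⟨hsq, h0⟩ := isSquare_sq_add_sq hp hne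
  have he : c = w ^ 2 / ((t ^ 2) ^ 2 + (m * z ^ 2) ^ 2) := by
    rw [eq_div_iff h0, h]
    ring
  rw [he]
  exact (IsSquare.sq w).div hsq

theorem isSquare_two_mul_of_sq_eq (hp : p ≠ 2) {i c m w t z : ℚ_[p]} (hi : i ^ 2 = -1)
    (hm : m ≠ 0) (hc : c ≠ 0) (hcv : Odd c.valuation) (htz : (t, z) ≠ (0, 0))
    (h : w ^ 2 = c * (t ^ 4 + m ^ 2 * z ^ 4)) : IsSquare (2 * m) := by
  have key : t ^ 4 + m ^ 2 * z ^ 4 ≠ 0 → ¬ Even (t ^ 4 + m ^ 2 * z ^ 4).valuation := by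
    intro h0 hev
    have := even_valuation_of_isSquare (IsSquare.sq w)
    rw [h, valuation_mul hc h0] at this
    exact (Int.not_even_iff_odd.2 (hcv.add_even hev)) this
  have heq : ‖t ^ 2‖ = ‖m * z ^ 2‖ := by
    by_contra hne
    have := isSquare_sq_add_sq hp hne
    rw [show (t ^ 2) ^ 2 + (m * z ^ 2) ^ 2 = t ^ 4 + m ^ 2 * z ^ 4 by ring] at this
    exact key this.2 (even_valuation_of_isSquare this.1)
  have hz : z ≠ 0 := by
    rintro rfl
    have ht : t = 0 := by simpa using heq
    exact htz (by rw [ht])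
  set u := t ^ 2 / (m * z ^ 2) with hu
  have hy : m * z ^ 2 ≠ 0 := mul_ne_zero hm (pow_ne_zero 2 hz)
  have hu1 : ‖u‖ = 1 := by
    rw [hu, norm_div, heq, div_self (norm_ne_zero_iff.2 hy)]
  have htu : t ^ 2 = u * (m * z ^ 2) := by rw [hu, div_mul_cancel₀ _ hy]
  have hfac : t ^ 4 + m ^ 2 * z ^ 4 = (m * z ^ 2) ^ 2 * (1 + u ^ 2) := by
    linear_combination (t ^ 2 + u * (m * z ^ 2)) * htu
  have hi1 : ‖i‖ = 1 := by
    have : ‖i‖ ^ 2 = 1 := by rw [← norm_pow, hi, norm_neg, norm_one]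
    exact (pow_eq_one_iff_of_nonneg (norm_nonneg i) two_ne_zero).1 this
  -- `i * u` is close to `±1`.
  have hlt : ‖i * u - 1‖ < 1 ∨ ‖-(i * u) - 1‖ < 1 := by
    by_contra! hge
    have hprod : 1 ≤ ‖1 + u ^ 2‖ := by
      have : 1 + u ^ 2 = (i * u - 1) * (-(i * u) - 1) := by linear_combination u ^ 2 * hi
      rw [this, norm_mul]
      nlinarith [hge.1, hge.2]
    have h0 : 1 + u ^ 2 ≠ 0 := norm_pos_iff.1 (by linarith)
    have hle : ‖1 + u ^ 2‖ ≤ 1 := by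
      simpa [hu1, -norm_pow] using (Padic.nonarchimedean 1 (u ^ 2)).trans
        (max_le norm_one.le (by rw [norm_pow, hu1, one_pow]))
    have hv : (1 + u ^ 2).valuation = 0 := by
      by_contra hv
      have hp1 : 1 < (p : ℝ) := by exact_mod_cast (Fact.out : p.Prime).one_lt
      have h1 := le_antisymm hle hprod
      rw [norm_eq_zpow_neg_valuation h0] at h1
      exact hv (by simpa using (zpow_eq_one_iff_right₀ (by linarith) hp1.ne').1 h1)
    refine key (hfac ▸ mul_ne_zero (pow_ne_zero 2 hy) h0) ?_
    rw [hfac, valuation_mul (pow_ne_zero 2 hy) h0, hv, add_zero]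
    exact even_valuation_of_isSquare (IsSquare.sq _)
  have hiu : IsSquare (i * u) := by
    have hneg : IsSquare (-1 : ℚ_[p]) := ⟨i, by rw [← hi, pow_two]⟩
    rcases hlt with h | h
    · exact isSquare_of_norm_sub_one_lt_one hp h
    · have := hneg.mul (isSquare_of_norm_sub_one_lt_one hp h)
      simpa using this
  obtain ⟨s, hs⟩ := hiu
  have hs0 : s ≠ 0 := by
    rintro rfl
    have := congrArg norm hs
    simp [hi1, hu1] at this
  refine ⟨(1 + i) * t / (z * s), ?_⟩
  field_simp
  linear_combination (-2 * z ^ 2 * m) * hs - 2 * i * htu - t ^ 2 * hi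

theorem odd_valuation_intCast {k : ℤ} (h : (p : ℤ) ∣ k) (h' : ¬ (p : ℤ) ^ 2 ∣ k) :
    Odd (k : ℚ_[p]).valuation := by
  have hk : k ≠ 0 := by
    rintro rfl
    exact h' (dvd_zero _)
  have h1 := (padicValInt_dvd_iff (p := p) 1 k).1 (by simpa using h)
  have h2 := mt (padicValInt_dvd_iff (p := p) 2 k).2 h'
  have : padicValInt p k = 1 := by
    have := h1.resolve_left hk
    push Not at h2
    omega
  rw [valuation_intCast, this]
  exact odd_one

end Padic

theorem Nat.mod_four_eq_one_of_forall_prime {k : ℕ} (hk : k ≠ 0)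
    (h : ∀ p : ℕ, p.Prime → p ∣ k → p % 4 = 1) : k % 4 = 1 := by
  induction k using Nat.recOnMul with
  | zero => exact absurd rfl hk
  | one => rfl
  | prime p hp => exact h p hp dvd_rfl
  | mul a b ha hb =>
    rw [Nat.mul_mod, ha (left_ne_zero_of_mul hk) fun p hp hd => h p hp (hd.mul_right b),
      hb (right_ne_zero_of_mul hk) fun p hp hd => h p hp (hd.mul_left a)]

theorem two_mul_mul_sq_eq_iff {K : Type*} [Field K] [CharZero K] {d m w t z : K} (hd : d ≠ 0) :
    2 * d * w ^ 2 = (2 * d) ^ 2 * t ^ 4 + 4 * (d * m) ^ 2 * z ^ 4 ↔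
      w ^ 2 = 2 * d * (t ^ 4 + m ^ 2 * z ^ 4) := by
  rw [← mul_right_inj' (a := 2 * d) (b := w ^ 2) (mul_ne_zero two_ne_zero hd)]
  exact Eq.congr_right (by ring)

theorem exists_padic_two_sq_eq {d m : ℕ} (hd : d % 4 = 1) (hdm : d * m % 8 = 1) :
    ∃ w : ℚ_[2], w ^ 2 = 2 * d * (1 + (m : ℚ_[2]) ^ 2) := by
  obtain ⟨j, hj, hdj⟩ : ∃ j, 1 + m ^ 2 = 2 * j ∧ d * j % 8 = 1 := by
    have hm : d % 8 = 1 ∧ m % 8 = 1 ∨ d % 8 = 5 ∧ m % 8 = 5 := by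
      have h1 : d % 8 = 1 ∨ d % 8 = 5 := by omega
      have h2 : m % 8 < 8 := Nat.mod_lt _ (by norm_num)
      rw [Nat.mul_mod] at hdm
      rcases h1 with h1 | h1 <;> rw [h1] at hdm ⊢ <;> omega
    rcases hm with ⟨h1, h2⟩ | ⟨h1, h2⟩
    · refine ⟨32 * (m / 8) ^ 2 + 8 * (m / 8) + 1, ?_, ?_⟩
      · rw [show m = 8 * (m / 8) + 1 by omega]
        simp only [show (8 * (m / 8) + 1) / 8 = m / 8 by omega]
        ring
      · rw [Nat.mul_mod, h1]
        omega
    · refine ⟨32 * (m / 8) ^ 2 + 40 * (m / 8) + 13, ?_, ?_⟩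
      · rw [show m = 8 * (m / 8) + 5 by omega]
        simp only [show (8 * (m / 8) + 5) / 8 = m / 8 by omega]
        ring
      · rw [Nat.mul_mod, h1]
        omega
  have hdvd : ((2 : ℕ) ^ 3 : ℤ) ∣ 1 - (d * j : ℕ) := by
    norm_num
    omega
  have hsq : IsSquare (((d * j : ℕ) : ℤ) : ℤ_[2]) := by
    refine PadicInt.isSquare_of_norm_sq_sub_lt (b := 1) ?_
    have h := PadicInt.norm_int_le_pow_iff_dvd.2 hdvd
    have h2 : ‖(2 : ℤ_[2])‖ = 2⁻¹ := by simpa using PadicInt.norm_p (p := 2)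
    rw [mul_one, h2, one_pow]
    push_cast at h ⊢
    refine h.trans_lt ?_
    norm_num
  obtain ⟨c, hc⟩ := hsq.map PadicInt.Coe.ringHom
  refine ⟨2 * c, ?_⟩
  have hj' : (1 + (m : ℚ_[2]) ^ 2) = 2 * j := by exact_mod_cast hj
  have hc' : (d : ℚ_[2]) * j = c * c := by simpa using hc
  rw [hj']
  linear_combination -4 * hc'

/-- Local solvability of `C_{2d} : 2d·w² = 4d²t⁴ + 4n²z⁴` for a divisor `d` of `n`. -/
theorem sLocSolvC_two_mul_iff
    (n : ℕ) (hpos : 0 < n) (hsf : Squarefree n) (hn8 : n % 8 = 1)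
    (hp4 : ∀ p : ℕ, p.Prime → p ∣ n → p % 4 = 1)
    (d : ℤ) (hdvd : d ∣ (n : ℤ)) :
    SLocSolvC n (2 * d) ↔
      0 < d ∧ (∀ p : ℕ, p.Prime → (p : ℤ) ∣ d → jacobiSym (2 * (n : ℤ) / d) p = 1) ∧
      (∀ p : ℕ, p.Prime → (p : ℤ) ∣ ((n : ℤ) / d) → jacobiSym (2 * d) p = 1) := by
  obtain ⟨m, hm⟩ := hdvd
  have hn0 : (n : ℤ) ≠ 0 := by exact_mod_cast hpos.ne'
  have hd0 : d ≠ 0 := left_ne_zero_of_mul (hm ▸ hn0)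
  have hm0 : m ≠ 0 := right_ne_zero_of_mul (hm ▸ hn0)
  have hsfZ : Squarefree (d * m) := hm ▸ Int.squarefree_natCast.2 hsf
  have hdiv : (n : ℤ) / d = m := by rw [hm, Int.mul_ediv_cancel_left _ hd0]
  have hdiv2 : 2 * (n : ℤ) / d = 2 * m := by
    rw [hm, mul_left_comm, Int.mul_ediv_cancel_left _ hd0]
  rw [hdiv, hdiv2]
  have hmod : ∀ p : ℕ, p.Prime → (p : ℤ) ∣ d * m → p % 4 = 1 := fun p hp h =>
    hp4 p hp (by exact_mod_cast hm ▸ h)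
  have hnot2 : ∀ p : ℕ, p.Prime → p ≠ 2 → ¬ (p : ℤ) ∣ 2 := fun p hp hp2 h =>
    hp2 ((Nat.prime_dvd_prime_iff_eq hp Nat.prime_two).1 (by exact_mod_cast h))
  have hnotboth : ∀ p : ℕ, p.Prime → (p : ℤ) ∣ d → ¬ (p : ℤ) ∣ m := fun p hp h h' =>
    (Nat.prime_iff_prime_int.1 hp).not_isUnit (hsfZ _ (mul_dvd_mul h h'))
  have hcast : ∀ (K : Type) [Field K] [CharZero K] (w t z : K),
      ((2 * d : ℤ) : K) * w ^ 2 = ((2 * d : ℤ) : K) ^ 2 * t ^ 4 + 4 * (n : K) ^ 2 * z ^ 4 ↔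
        w ^ 2 = 2 * d * (t ^ 4 + (m : K) ^ 2 * z ^ 4) := fun K _ _ w t z => by
    rw [← Int.cast_natCast (R := K) n, hm, ← two_mul_mul_sq_eq_iff (Int.cast_ne_zero.2 hd0)]
    push_cast
    rfl
  simp only [SLocSolvC, hcast]
  constructor
  · rintro ⟨⟨w, t, z, htz, h⟩, hloc⟩
    refine ⟨?_, fun p hp hpd => ?_, fun p hp hpm => ?_⟩
    · have hm0' : (m : ℝ) ≠ 0 := Int.cast_ne_zero.2 hm0
      have hpos' : 0 < t ^ 4 + (m : ℝ) ^ 2 * z ^ 4 := by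
        by_cases ht : t = 0
        · have hz : z ≠ 0 := fun hz => htz (by rw [ht, hz])
          positivity
        · positivity
      have hd : (0 : ℝ) ≤ d := by
        by_contra! hneg
        nlinarith [sq_nonneg w, mul_neg_of_neg_of_pos hneg hpos']
      exact lt_of_le_of_ne (by exact_mod_cast hd) hd0.symm
    · have := Fact.mk hp
      have hp1 := hmod p hp (hpd.mul_right m)
      have hp2 : p ≠ 2 := by rintro rfl; omega
      have hpr := Nat.prime_iff_prime_int.1 hp
      obtain ⟨w, t, z, htz, h⟩ := hloc p
        (by exact_mod_cast (hm ▸ hpd.mul_right m : (p : ℤ) ∣ n).mul_left 2)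
      obtain ⟨i, hi⟩ := Padic.exists_sq_eq_neg_one hp1
      rw [Padic.jacobiSym_eq_one_iff_isSquare hp2 (fun hd =>
        (hpr.dvd_or_dvd hd).elim (hnot2 p hp hp2) (hnotboth p hp hpd))]
      push_cast
      have hval : ¬ (p : ℤ) ^ 2 ∣ 2 * d := fun hd =>
        hpr.not_isUnit (hsfZ.of_mul_left _ (by
          rw [← pow_two]
          exact (IsCoprime.pow_left
            ((Prime.coprime_iff_not_dvd hpr).2 (hnot2 p hp hp2))).dvd_of_dvd_mul_left hd))
      refine Padic.isSquare_two_mul_of_sq_eq hp2 hi (Int.cast_ne_zero.2 hm0)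
        (mul_ne_zero two_ne_zero (Int.cast_ne_zero.2 hd0)) ?_ htz h
      exact_mod_cast Padic.odd_valuation_intCast (hpd.mul_left 2) hval
    · have := Fact.mk hp
      have hp1 := hmod p hp (hpm.mul_left d)
      have hp2 : p ≠ 2 := by rintro rfl; omega
      have hpr := Nat.prime_iff_prime_int.1 hp
      obtain ⟨w, t, z, htz, h⟩ := hloc p
        (by exact_mod_cast (hm ▸ hpm.mul_left d : (p : ℤ) ∣ n).mul_left 2)
      rw [Padic.jacobiSym_eq_one_iff_isSquare hp2 (fun hd =>
        (hpr.dvd_or_dvd hd).elim (hnot2 p hp hp2) (fun hd => hnotboth p hp hd hpm))]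
      push_cast
      refine Padic.isSquare_of_sq_eq_of_odd_valuation hp2 (Int.cast_ne_zero.2 hm0)
        (Padic.odd_valuation_intCast hpm fun hd => ?_) htz h
      exact hpr.not_isUnit (hsfZ.of_mul_right _ (by rwa [← pow_two]))
  · rintro ⟨hd, hpd, hpm⟩
    have hd' : (0 : ℝ) ≤ d := by exact_mod_cast hd.le
    refine ⟨⟨√(2 * d), 1, 0, by simp, ?_⟩, fun p hF hp2n => ?_⟩
    · rw [Real.sq_sqrt (by positivity)]
      ring
    have hp := hF.out
    by_cases hp2 : p = 2
    · subst hp2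
      have hmpos : 0 < m := pos_of_mul_pos_right (hm ▸ by exact_mod_cast hpos) hd.le
      lift d to ℕ using hd.le
      lift m to ℕ using hmpos.le
      obtain ⟨w, hw⟩ := exists_padic_two_sq_eq (d := d) (m := m)
        (Nat.mod_four_eq_one_of_forall_prime (by exact_mod_cast hd0) fun p hp h =>
          hmod p hp ((Int.natCast_dvd_natCast.2 h).mul_right _))
        (by rw [← hn8]; congr 1; exact_mod_cast hm.symm)
      exact ⟨w, 1, 1, by simp, by simpa using hw⟩
    have hpr := Nat.prime_iff_prime_int.1 hp
    have hpn : (p : ℤ) ∣ d * m := by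
      refine (hpr.dvd_or_dvd (?_ : (p : ℤ) ∣ 2 * (d * m))).resolve_left (hnot2 p hp hp2)
      rw [← hm]
      exact_mod_cast hp2n
    rcases hpr.dvd_or_dvd hpn with h | h
    · obtain ⟨s, hs⟩ := (Padic.jacobiSym_eq_one_iff_isSquare hp2 (fun hd =>
        (hpr.dvd_or_dvd hd).elim (hnot2 p hp hp2) (hnotboth p hp h))).1 (hpd p hp h)
      obtain ⟨i, hi⟩ := Padic.exists_sq_eq_neg_one (hmod p hp hpn)
      push_cast at hs
      -- `t² = i * m`
      refine ⟨0, (1 + i) * s / 2, 1, by simp, ?_⟩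
      have ht : ((1 + i) * s / 2) ^ 2 = i * m := by
        linear_combination (s ^ 2 / 4) * hi - i / 2 * hs
      rw [show ((1 + i) * s / 2) ^ 4 = (((1 + i) * s / 2) ^ 2) ^ 2 by ring, ht]
      linear_combination -2 * d * (m : ℚ_[p]) ^ 2 * hi
    · obtain ⟨s, hs⟩ := (Padic.jacobiSym_eq_one_iff_isSquare hp2 (fun hd =>
        (hpr.dvd_or_dvd hd).elim (hnot2 p hp hp2) (fun hd => hnotboth p hp hd h))).1
          (hpm p hp h)
      push_cast at hs
      exact ⟨s, 1, 0, by simp, by linear_combination -hs⟩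

end
end

section
/- Let G be a finite simple undirected graph with k vertices and let r be the rank over 𝔽₂ of its Laplace matrix L(G). Then the number of even partitions of the vertex set V of G (where a partition V = V₀ ∪ V₁ is identified with V = V₁ ∪ V₀) equals 2^{k−1−r}. -/
noncomputable section

/-- A partition `V = S ∪ Sᶜ` is even if every vertex has an even number of neighbours lying on
the other side of the partition. -/
def IsEvenPartition {V : Type*} (G : SimpleGraph V) (S : Set V) : Prop :=
  ∀ v : V, Even {w : V | G.Adj v w ∧ ((w ∈ S) ↔ (v ∉ S))}.ncard

/-- The Laplace matrix `L(G) = diag(d₁,…,d_k) - M(G)` of a graph, regarded over `𝔽₂`. -/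
def lapMat {V : Type*} [Fintype V] [DecidableEq V] (G : SimpleGraph V) [DecidableRel G.Adj] :
    Matrix V V (ZMod 2) :=
  Matrix.diagonal (fun v => (G.degree v : ZMod 2)) - G.adjMatrix (ZMod 2)

theorem isEvenPartition_compl {V : Type*} (G : SimpleGraph V) (S : Set V) :
    IsEvenPartition G Sᶜ ↔ IsEvenPartition G S := by
  unfold IsEvenPartition
  refine forall_congr' fun v => ?_
  have h : {w : V | G.Adj v w ∧ ((w ∈ Sᶜ) ↔ (v ∉ Sᶜ))} =
      {w : V | G.Adj v w ∧ ((w ∈ S) ↔ (v ∉ S))} := by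
    ext w
    simp only [Set.mem_ofPred_eq, Set.mem_compl_iff]
    tauto
  rw [h]

/-- The equivalence between `𝔽₂`-valued functions and sets, by taking supports. -/
def zmodTwoFunEquivSet (V : Type*) : (V → ZMod 2) ≃ Set V where
  toFun x := {v | x v = 1}
  invFun S := by
    classical
    exact fun v => if v ∈ S then 1 else 0
  left_inv x := by
    funext v
    have h : ∀ a : ZMod 2, (if a = 1 then (1 : ZMod 2) else 0) = a := by decide
    convert h (x v)
    exact Iff.rfl
  right_inv S := by
    ext v
    by_cases h : v ∈ S <;> simp [h]

theorem lapMat_mulVec_apply {V : Type*} [Fintype V] [DecidableEq V] (G : SimpleGraph V)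
    [DecidableRel G.Adj] (x : V → ZMod 2) (v : V) :
    (lapMat G).mulVec x v =
      (({w : V | G.Adj v w ∧ (x w = 1 ↔ ¬ x v = 1)}.ncard : ℕ) : ZMod 2) := by
  have h : ∀ a b : ZMod 2, b - a = if (a = 1 ↔ ¬ b = 1) then 1 else 0 := by decide
  have hs : {w : V | G.Adj v w ∧ (x w = 1 ↔ ¬ x v = 1)} =
      ((G.neighborFinset v).filter (fun w => (x w = 1 ↔ ¬ x v = 1)) : Finset V) := by
    ext w
    simp
  rw [hs, Set.ncard_coe_finset, Finset.card_filter, lapMat, Matrix.sub_mulVec, Pi.sub_apply,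
    Matrix.mulVec_diagonal, SimpleGraph.adjMatrix_mulVec_apply]
  push_cast
  simp only [← h]
  rw [Finset.sum_sub_distrib, Finset.sum_const, SimpleGraph.card_neighborFinset_eq_degree,
    nsmul_eq_mul]

theorem mem_ker_lapMat_iff {V : Type*} [Fintype V] [DecidableEq V] (G : SimpleGraph V)
    [DecidableRel G.Adj] (x : V → ZMod 2) :
    x ∈ LinearMap.ker (lapMat G).mulVecLin ↔ IsEvenPartition G (zmodTwoFunEquivSet V x) := by
  rw [LinearMap.mem_ker, Matrix.mulVecLin_apply, funext_iff]
  refine forall_congr' fun v => ?_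
  rw [lapMat_mulVec_apply, Pi.zero_apply, ZMod.natCast_eq_zero_iff_even]
  rfl

theorem ncard_isEvenPartition {V : Type*} [Fintype V] [DecidableEq V] (G : SimpleGraph V)
    [DecidableRel G.Adj] :
    {S : Set V | IsEvenPartition G S}.ncard = 2 ^ (Fintype.card V - (lapMat G).rank) := by
  have hcard : Nat.card (LinearMap.ker (lapMat G).mulVecLin) =
      {S : Set V | IsEvenPartition G S}.ncard :=
    Nat.card_congr ((zmodTwoFunEquivSet V).subtypeEquiv (mem_ker_lapMat_iff G))
  have hrank := (lapMat G).mulVecLin.finrank_range_add_finrank_ker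
  rw [Module.finrank_pi] at hrank
  rw [← hcard, Module.natCard_eq_pow_finrank (K := ZMod 2), Nat.card_zmod, Matrix.rank,
    ← hrank, Nat.add_sub_cancel_left]

/-- For a nonempty vertex set, each unordered even partition comes from exactly two sets. -/
theorem two_mul_ncard_unordered {V : Type*} [Finite V] [Nonempty V] (G : SimpleGraph V) :
    2 * {P : Set (Set V) | ∃ S : Set V, P = {S, Sᶜ} ∧ IsEvenPartition G S}.ncard =
      {S : Set V | IsEvenPartition G S}.ncard := by
  obtain ⟨v⟩ := ‹Nonempty V›
  set A : Set (Set V) := {S | IsEvenPartition G S ∧ v ∉ S}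
  have hP : {P : Set (Set V) | ∃ S : Set V, P = {S, Sᶜ} ∧ IsEvenPartition G S} =
      (fun S : Set V => ({S, Sᶜ} : Set (Set V))) '' A := by
    ext P
    constructor
    · rintro ⟨S, rfl, hS⟩
      by_cases hv : v ∈ S
      · refine ⟨Sᶜ, ⟨(isEvenPartition_compl G S).2 hS, fun h => h hv⟩, ?_⟩
        simp only [compl_compl]
        exact Set.pair_comm _ _
      · exact ⟨S, ⟨hS, hv⟩, rfl⟩
    · rintro ⟨S, hS, rfl⟩
      exact ⟨S, rfl, hS.1⟩
  have hinj : Set.InjOn (fun S : Set V => ({S, Sᶜ} : Set (Set V))) A := by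
    intro S hS T hT h
    have hmem : S ∈ ({T, Tᶜ} : Set (Set V)) := by
      rw [← show ({S, Sᶜ} : Set (Set V)) = {T, Tᶜ} from h]
      exact Set.mem_insert _ _
    rcases hmem with h | h
    · exact h
    · exact absurd (show v ∈ S from h ▸ hT.2) hS.2
  have hunion : {S : Set V | IsEvenPartition G S} = A ∪ compl '' A := by
    ext S
    constructor
    · intro hS
      by_cases hv : v ∈ S
      · exact Or.inr ⟨Sᶜ, ⟨(isEvenPartition_compl G S).2 hS, fun h => h hv⟩, compl_compl S⟩
      · exact Or.inl ⟨hS, hv⟩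
    · rintro (hS | ⟨T, hT, rfl⟩)
      · exact hS.1
      · exact (isEvenPartition_compl G T).2 hT.1
  have hdisj : Disjoint A (compl '' A) := by
    rw [Set.disjoint_left]
    rintro _ hS ⟨T, hT, rfl⟩
    exact hS.2 hT.2
  rw [hP, hinj.ncard_image, hunion, Set.ncard_union_eq hdisj,
    Set.ncard_image_of_injective A compl_injective, two_mul]

/-- The number of even partitions of (the vertex set of) `G` is `2^(k-1-r)` where `r` is the
`𝔽₂`-rank of the Laplace matrix. A partition `V = V₀ ∪ V₁` is identified with the unordered
pair `{V₀, V₁}`. -/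
theorem card_even_partitions {V : Type*} [Fintype V] [DecidableEq V]
    (G : SimpleGraph V) [DecidableRel G.Adj] (k r : ℕ)
    (hk : Fintype.card V = k) (hr : (lapMat G).rank = r) :
    {P : Set (Set V) | ∃ S : Set V, P = {S, Sᶜ} ∧ IsEvenPartition G S}.ncard =
      2 ^ (k - 1 - r) := by
  rcases isEmpty_or_nonempty V with hV | hV
  · have hP : {P : Set (Set V) | ∃ S : Set V, P = {S, Sᶜ} ∧ IsEvenPartition G S} =
        {{∅}} := by
      ext P
      constructor
      · rintro ⟨S, rfl, -⟩
        simp [Set.eq_empty_of_isEmpty]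
      · rintro rfl
        exact ⟨∅, by simp [Set.eq_empty_of_isEmpty], fun v => isEmptyElim v⟩
    have hk0 : k = 0 := by rw [← hk, Fintype.card_eq_zero]
    simp [hP, hk0]
  · have h := two_mul_ncard_unordered G
    rw [ncard_isEvenPartition, hk, hr] at h
    rw [Nat.sub_right_comm]
    cases hn : k - r with
    | zero => rw [hn, pow_zero] at h; omega
    | succ n => rw [hn, pow_succ] at h; rw [Nat.add_sub_cancel]; omega

end
end

section
/- Let G be a finite simple undirected graph with k vertices. Then G is odd (i.e., its only even partition is the trivial partition V = ∅ ∪ V) if and only if the rank over 𝔽₂ of its Laplace matrix L(G) equals k − 1. -/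
noncomputable section

/-- A graph is odd if its only even partition is the trivial one `V = ∅ ∪ V`. -/
def IsOddGraph {V : Type*} (G : SimpleGraph V) : Prop :=
  ∀ S : Set V, IsEvenPartition G S → S = ∅ ∨ S = Set.univ

/-- At `v`, the product of the Laplace matrix with the indicator vector of `S` counts the
neighbours of `v` across the partition `S ∪ Sᶜ`. -/
theorem lapMat_mulVec_indicator_apply {V : Type*} [Fintype V] [DecidableEq V]
    (G : SimpleGraph V) [DecidableRel G.Adj] (S : Set V) (v : V) :
    (lapMat G).mulVec (S.indicator 1) v =
      ({w : V | G.Adj v w ∧ ((w ∈ S) ↔ (v ∉ S))}.ncard : ZMod 2) := by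
  classical
  have h : {w : V | G.Adj v w ∧ ((w ∈ S) ↔ (v ∉ S))} =
      ↑((G.neighborFinset v).filter fun w => (w ∈ S) ↔ (v ∉ S)) := by
    ext w
    simp
  rw [h, Set.ncard_coe_finset, Finset.natCast_card_filter, lapMat, Matrix.sub_mulVec,
    Pi.sub_apply, Matrix.mulVec_diagonal, SimpleGraph.adjMatrix_mulVec_apply,
    ← SimpleGraph.card_neighborFinset_eq_degree, ← nsmul_eq_mul, ← Finset.sum_const,
    ← Finset.sum_sub_distrib]
  refine Finset.sum_congr rfl fun w _ => ?_
  by_cases hv : v ∈ S <;> by_cases hw : w ∈ S <;> simp [hv, hw]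

theorem isEvenPartition_iff_lapMat_mulVec_eq_zero {V : Type*} [Fintype V] [DecidableEq V]
    (G : SimpleGraph V) [DecidableRel G.Adj] (S : Set V) :
    IsEvenPartition G S ↔ (lapMat G).mulVec (S.indicator 1) = 0 := by
  simp only [IsEvenPartition, funext_iff, lapMat_mulVec_indicator_apply, Pi.zero_apply,
    ZMod.natCast_eq_zero_iff_even]

theorem exists_zmod_two {p : ZMod 2 → Prop} : (∃ c, p c) ↔ p 0 ∨ p 1 :=
  Fin.exists_fin_two

theorem indicator_support_zmod_two {V : Type*} (x : V → ZMod 2) :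
    (Function.support x).indicator 1 = x := by
  ext v
  by_cases h : x v = 0
  · simp [h]
  · exact (Set.indicator_of_mem h _).trans (Fin.eq_one_of_ne_zero _ h).symm

theorem isOddGraph_iff_ker {V : Type*} [Fintype V] [DecidableEq V]
    (G : SimpleGraph V) [DecidableRel G.Adj] :
    IsOddGraph G ↔ ∀ x, (lapMat G).mulVec x = 0 → x = 0 ∨ x = 1 := by
  simp only [IsOddGraph, isEvenPartition_iff_lapMat_mulVec_eq_zero]
  constructor
  · intro h x hx
    rw [← indicator_support_zmod_two x] at hx ⊢
    refine (h _ hx).imp (fun h => ?_) fun h => ?_ <;> rw [h]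
    · exact Set.indicator_empty _
    · exact Set.indicator_univ _
  · intro h S hS
    refine (h _ hS).imp (fun h => ?_) fun h => ?_ <;> ext v <;>
      simpa [Set.indicator] using congrFun h v

theorem lapMat_mulVec_one {V : Type*} [Fintype V] [DecidableEq V]
    (G : SimpleGraph V) [DecidableRel G.Adj] : (lapMat G).mulVec 1 = 0 := by
  ext v
  simpa using lapMat_mulVec_indicator_apply G Set.univ v

/-- `G` is odd iff the `𝔽₂`-rank of its Laplace matrix is `k - 1`. -/
theorem isOddGraph_iff_rank {V : Type*} [Fintype V] [DecidableEq V]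
    (G : SimpleGraph V) [DecidableRel G.Adj] (k : ℕ) (hk : Fintype.card V = k) :
    IsOddGraph G ↔ (lapMat G).rank = k - 1 := by
  subst hk
  rw [isOddGraph_iff_ker]
  rcases isEmpty_or_nonempty V with hV | hV
  · have hr := (lapMat G).rank_le_card_width
    rw [Fintype.card_eq_zero] at hr ⊢
    exact iff_of_true (fun x _ => .inl (Subsingleton.elim _ _)) (by omega)
  · have hdim := (lapMat G).mulVecLin.finrank_range_add_finrank_ker
    rw [Module.finrank_fintype_fun_eq_card] at hdim
    have hpos : 0 < Fintype.card V := Fintype.card_pos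
    have hrank : (lapMat G).rank = Fintype.card V - 1 ↔
        Module.finrank (ZMod 2) (LinearMap.ker (lapMat G).mulVecLin) = 1 := by
      rw [Matrix.rank]
      have : 0 < Module.finrank (ZMod 2) (LinearMap.ker (lapMat G).mulVecLin) :=
        Module.finrank_pos_iff_exists_ne_zero.2
          ⟨⟨1, lapMat_mulVec_one G⟩, fun h => one_ne_zero (congrArg Subtype.val h)⟩
      omega
    rw [hrank, finrank_eq_one_iff_of_nonzero'
      (⟨1, lapMat_mulVec_one G⟩ : LinearMap.ker (lapMat G).mulVecLin)
      fun h => one_ne_zero (congrArg Subtype.val h)]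
    simp only [Subtype.forall, LinearMap.mem_ker, Matrix.mulVecLin_apply, Subtype.ext_iff,
      Submodule.coe_smul]
    refine forall₂_congr fun x _ => ?_
    rw [exists_zmod_two, zero_smul, one_smul, eq_comm (a := x), eq_comm (a := x)]

end
end

section
/- Let n be a squarefree positive integer with n ≡ 1 (mod 8) all of whose prime factors are ≡ 1 (mod 4), and let d be a positive divisor of n. Let τ, μ, τ', μ' be integers with 2d = τ² + μ² and 2n/d = τ'² + μ'², and let i be an integer with μ·i ≡ τ (mod d) and μ'·i ≡ τ' (mod n/d). Then [(τ+μi)/n] + [2/d] = [(τ'+μ'i)/n] + [2/(n/d)] in 𝔽₂; that is, the value δ obtained from the pair (d, τ, μ) equals the value obtained from the swapped pair (n/d, τ', μ'). -/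
noncomputable section

/-- The additive symbol `[a/m] = (1 - (a/m))/2 ∈ 𝔽₂`, where `(a/m)` is the Jacobi symbol. -/
def jacobiBr (a : ℤ) (m : ℕ) : ZMod 2 := (((1 - jacobiSym a m) / 2 : ℤ) : ZMod 2)

theorem isCoprime_of_squarefree_eq_sq_add_sq {x y N : ℤ} (hN : Squarefree N)
    (h : N = x ^ 2 + y ^ 2) : IsCoprime x y := by
  rw [Int.isCoprime_iff_gcd_eq_one]
  obtain ⟨u, hu⟩ := Int.gcd_dvd_left x y
  obtain ⟨v, hv⟩ := Int.gcd_dvd_right x y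
  set g : ℤ := (Int.gcd x y : ℤ) with hg
  have hdvd : g * g ∣ N := ⟨u ^ 2 + v ^ 2, by rw [h, hu, hv]; ring⟩
  have := Int.isUnit_iff_natAbs_eq.1 (hN g hdvd)
  simpa [hg] using this

theorem isCoprime_left_of_squarefree_eq_sq_add_sq {x y k d : ℤ} (hN : Squarefree (k * d))
    (h : k * d = x ^ 2 + y ^ 2) : IsCoprime x d := by
  have hxy : IsCoprime x (k * d) := by
    rw [h, sq x, add_comm, IsCoprime.add_mul_left_right_iff]
    exact (isCoprime_of_squarefree_eq_sq_add_sq hN h).pow_right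
  exact hxy.of_mul_right_right

theorem jacobiSym_sq_one_of_isCoprime {a : ℤ} {m : ℕ} (h : IsCoprime a m) :
    jacobiSym a m ^ 2 = 1 :=
  jacobiSym.sq_one (Int.isCoprime_iff_gcd_eq_one.1 h)

theorem isCoprime_two_natCast {d : ℕ} (hd : Odd d) : IsCoprime (2 : ℤ) d := by
  exact_mod_cast Nat.isCoprime_iff_coprime.2 (Nat.coprime_two_left.2 hd)

/-- If `d` divides `x² + y²`, then `2xy ≡ (x + y)²` is a square modulo `d`. -/
theorem jacobiSym_mul_eq_jacobiSym_two {x y k : ℤ} {d : ℕ} (hd : Odd d)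
    (hx : IsCoprime x d) (hy : IsCoprime y d) (h : k * d = x ^ 2 + y ^ 2) :
    jacobiSym x d * jacobiSym y d = jacobiSym 2 d := by
  have h2 := isCoprime_two_natCast hd
  have hmod : jacobiSym ((x + y) ^ 2) d = jacobiSym (2 * (x * y)) d := by
    apply jacobiSym.mod_left'
    apply Int.ModEq.symm
    rw [Int.modEq_iff_dvd]
    exact ⟨k, by linear_combination -h⟩
  have hs := jacobiSym_sq_one_of_isCoprime (h2.mul_left (hx.mul_left hy))
  have h1 : jacobiSym (2 * (x * y)) d = 1 := by
    have : 0 ≤ jacobiSym (2 * (x * y)) d := by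
      rw [← hmod, jacobiSym.pow_left]; positivity
    nlinarith
  rw [jacobiSym.mul_left, jacobiSym.mul_left] at h1
  have h22 := jacobiSym_sq_one_of_isCoprime h2
  linear_combination jacobiSym 2 d * h1 - jacobiSym x d * jacobiSym y d * h22

theorem jacobiSym_eq_one_of_odd_of_eq_sq_add_sq {a b : ℤ} {n : ℕ} (hn : n % 4 = 1)
    (hab : IsCoprime a b) (hb : Odd b) (h : (n : ℤ) = a ^ 2 + b ^ 2) : jacobiSym b n = 1 := by
  have hnodd : Odd n := Nat.odd_iff.2 (by omega)
  have hbodd : Odd b.natAbs := Int.natAbs_odd.2 hb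
  have habs : jacobiSym b n = jacobiSym (b.natAbs : ℤ) n := by
    rcases Int.natAbs_eq b with hb' | hb'
    · rw [← hb']
    · conv_lhs => rw [hb']
      rw [jacobiSym.neg _ hnodd, ZMod.χ₄_nat_one_mod_four hn, one_mul]
  rw [habs, ← jacobiSym.quadratic_reciprocity_one_mod_four hn hbodd]
  have hmod : jacobiSym (n : ℤ) b.natAbs = jacobiSym (a ^ 2) b.natAbs := by
    apply jacobiSym.mod_left'
    apply Int.ModEq.symm
    rw [Int.modEq_iff_dvd]
    exact Int.natAbs_dvd.2 ⟨b, by linear_combination h⟩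
  rw [hmod, jacobiSym.pow_left]
  apply jacobiSym_sq_one_of_isCoprime
  rcases Int.natAbs_eq b with hb' | hb'
  · rwa [← hb']
  · exact (IsCoprime.neg_right_iff _ _).1 (hb' ▸ hab)

theorem jacobiSym_two_eq_one {n : ℕ} (hn : n % 8 = 1) : jacobiSym 2 n = 1 := by
  rw [jacobiSym.at_two (Nat.odd_iff.2 (by omega)), ZMod.χ₈_nat_eq_if_mod_eight]
  have : ¬ n % 2 = 0 := by omega
  simp [this, hn]

theorem jacobiSym_eq_one_of_eq_sq_add_sq {a b : ℤ} {n : ℕ} (hn : n % 8 = 1) (hsf : Squarefree n)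
    (h : (n : ℤ) = a ^ 2 + b ^ 2) : jacobiSym a n = 1 := by
  have hsf' : Squarefree (1 * (n : ℤ)) := by simpa using Int.squarefree_natCast.2 hsf
  have h' : 1 * (n : ℤ) = a ^ 2 + b ^ 2 := by rw [one_mul, h]
  have hab := isCoprime_of_squarefree_eq_sq_add_sq hsf' h'
  rcases Int.even_or_odd b with hb | hb
  · apply jacobiSym_eq_one_of_odd_of_eq_sq_add_sq (by omega) hab.symm _ (by rw [h, add_comm])
    have : Odd (a ^ 2 + b ^ 2) := by
      rw [← h]; exact_mod_cast Nat.odd_iff.2 (by omega : n % 2 = 1)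
    rw [Int.odd_add, Int.odd_pow' two_ne_zero] at this
    exact this.2 (hb.pow_of_ne_zero two_ne_zero)
  · have hb1 := jacobiSym_eq_one_of_odd_of_eq_sq_add_sq (by omega) hab hb h
    have hm := jacobiSym_mul_eq_jacobiSym_two (Nat.odd_iff.2 (by omega))
      (isCoprime_left_of_squarefree_eq_sq_add_sq hsf' h')
      (isCoprime_left_of_squarefree_eq_sq_add_sq hsf' (h'.trans (add_comm _ _))) h'
    rwa [hb1, mul_one, jacobiSym_two_eq_one hn] at hm

theorem odd_of_two_mul_eq_sq_add_sq {x y d : ℤ} (hd : Odd d) (h : 2 * d = x ^ 2 + y ^ 2) :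
    Odd x := by
  by_contra hx
  rw [Int.not_odd_iff_even] at hx
  have hy : Even y := by
    have : Even (x ^ 2 + y ^ 2) := by rw [← h]; exact even_two_mul d
    rw [Int.even_add, Int.even_pow' two_ne_zero, Int.even_pow' two_ne_zero] at this
    exact this.1 hx
  obtain ⟨u, rfl⟩ := hx
  obtain ⟨v, rfl⟩ := hy
  obtain ⟨w, rfl⟩ := hd
  have : 2 * w + 1 = 2 * (u ^ 2 + v ^ 2) := by linarith
  omega

theorem jacobiSym_add_mul_mul {x y u v i : ℤ} {d e : ℕ} (hx : (d : ℤ) ∣ y * i - x)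
    (hu : (e : ℤ) ∣ v * i - u) (hv : IsCoprime v e) [NeZero d] [NeZero e] :
    jacobiSym (x + y * i) (d * e) =
      jacobiSym 2 d * jacobiSym x d * (jacobiSym v e * jacobiSym (x * v + y * u) e) := by
  have hd : jacobiSym (x + y * i) d = jacobiSym (2 * x) d := by
    apply jacobiSym.mod_left'
    apply Int.ModEq.symm
    rw [Int.modEq_iff_dvd]
    rwa [show x + y * i - 2 * x = y * i - x by ring]
  have he : jacobiSym (v * (x + y * i)) e = jacobiSym (x * v + y * u) e := by
    apply jacobiSym.mod_left'
    apply Int.ModEq.symm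
    rw [Int.modEq_iff_dvd]
    rw [show v * (x + y * i) - (x * v + y * u) = y * (v * i - u) by ring]
    exact hu.mul_left y
  rw [jacobiSym.mul_right, hd, jacobiSym.mul_left, ← he, jacobiSym.mul_left]
  linear_combination -(jacobiSym 2 d * jacobiSym x d * jacobiSym (x + y * i) e) *
    jacobiSym_sq_one_of_isCoprime hv

/-- The Jacobi symbols underlying the swap invariance agree. -/
theorem jacobiSym_swap {d e : ℕ} {x y u v i : ℤ} (hn : d * e % 8 = 1) (hsf : Squarefree (d * e))
    (h1 : 2 * (d : ℤ) = x ^ 2 + y ^ 2) (h2 : 2 * (e : ℤ) = u ^ 2 + v ^ 2)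
    (h3 : (d : ℤ) ∣ y * i - x) (h4 : (e : ℤ) ∣ v * i - u) :
    jacobiSym (x + y * i) (d * e) = jacobiSym (u + v * i) (d * e) := by
  have hodd : Odd (d * e) := Nat.odd_iff.2 (by omega)
  obtain ⟨hd, he⟩ := Nat.odd_mul.1 hodd
  have : NeZero d := ⟨hd.pos.ne'⟩
  have : NeZero e := ⟨he.pos.ne'⟩
  have hsq : ∀ {m : ℕ}, Odd m → Squarefree m → Squarefree (2 * (m : ℤ)) := by
    intro m hm hs
    have : Squarefree (2 * m) :=
      (Nat.squarefree_mul (Nat.coprime_two_left.2 hm)).2 ⟨Nat.prime_two.squarefree, hs⟩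
    exact_mod_cast Int.squarefree_natCast.2 this
  have hsd := hsq hd (hsf.squarefree_of_dvd (dvd_mul_right d e))
  have hse := hsq he (hsf.squarefree_of_dvd (dvd_mul_left e d))
  have h1' := h1.trans (add_comm _ _)
  have h2' := h2.trans (add_comm _ _)
  have cx := isCoprime_left_of_squarefree_eq_sq_add_sq hsd h1
  have cy := isCoprime_left_of_squarefree_eq_sq_add_sq hsd h1'
  have cu := isCoprime_left_of_squarefree_eq_sq_add_sq hse h2
  have cv := isCoprime_left_of_squarefree_eq_sq_add_sq hse h2'
  have hdZ : Odd (d : ℤ) := by exact_mod_cast hd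
  have heZ : Odd (e : ℤ) := by exact_mod_cast he
  have ox := odd_of_two_mul_eq_sq_add_sq hdZ h1
  have oy := odd_of_two_mul_eq_sq_add_sq hdZ h1'
  have ou := odd_of_two_mul_eq_sq_add_sq heZ h2
  have ov := odd_of_two_mul_eq_sq_add_sq heZ h2'
  obtain ⟨a, ha⟩ := (ox.mul ov).add_odd (oy.mul ou)
  obtain ⟨b, hb⟩ := (ox.mul ou).sub_odd (oy.mul ov)
  have hab : ((d * e : ℕ) : ℤ) = a ^ 2 + b ^ 2 := by
    have : 4 * ((d : ℤ) * e) = (a + a) ^ 2 + (b + b) ^ 2 := by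
      rw [← ha, ← hb]
      linear_combination 2 * (e : ℤ) * h1 + (x ^ 2 + y ^ 2) * h2
    push_cast
    linarith
  have hA : jacobiSym (x * v + y * u) d * jacobiSym (x * v + y * u) e = 1 := by
    rw [← jacobiSym.mul_right, ha, ← two_mul, jacobiSym.mul_left, jacobiSym_two_eq_one hn,
      jacobiSym_eq_one_of_eq_sq_add_sq hn hsf hab, one_mul]
  have h2n : jacobiSym 2 d * jacobiSym 2 e = 1 := by
    rw [← jacobiSym.mul_right, jacobiSym_two_eq_one hn]
  have hxy := jacobiSym_mul_eq_jacobiSym_two hd cx cy h1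
  have huv := jacobiSym_mul_eq_jacobiSym_two he cu cv h2
  have hX := jacobiSym_add_mul_mul h3 h4 cv
  have hY := jacobiSym_add_mul_mul h4 h3 cy
  rw [mul_comm e d, show u * y + v * x = x * v + y * u by ring] at hY
  have hXY : jacobiSym (x + y * i) (d * e) * jacobiSym (u + v * i) (d * e) = 1 := by
    calc _ = (jacobiSym 2 d * jacobiSym 2 e) * (jacobiSym x d * jacobiSym y d) *
          (jacobiSym u e * jacobiSym v e) *
          (jacobiSym (x * v + y * u) d * jacobiSym (x * v + y * u) e) := by rw [hX, hY]; ring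
      _ = 1 := by rw [hA, hxy, huv, h2n, one_mul, h2n, one_mul]
  rcases Int.mul_eq_one_iff_eq_one_or_neg_one.1 hXY with h | h <;> rw [h.1, h.2]


/-- The quantity `δ = [(τ+μi)/n] + [2/d]` is unchanged when `(d, τ, μ)` is replaced by the
swapped data `(n/d, τ', μ')`. -/
theorem delta_swap_invariant
    (n d : ℕ) (hpos : 0 < n) (hsf : Squarefree n) (hn8 : n % 8 = 1)
    (hp4 : ∀ p : ℕ, p.Prime → p ∣ n → p % 4 = 1)
    (hdpos : 0 < d) (hdvd : d ∣ n)
    (τ μ τ' μ' i : ℤ)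
    (h1 : 2 * (d : ℤ) = τ ^ 2 + μ ^ 2) (h2 : 2 * ((n : ℤ) / d) = τ' ^ 2 + μ' ^ 2)
    (h3 : (d : ℤ) ∣ μ * i - τ) (h4 : ((n / d : ℕ) : ℤ) ∣ μ' * i - τ') :
    jacobiBr (τ + μ * i) n + jacobiBr 2 d =
      jacobiBr (τ' + μ' * i) n + jacobiBr 2 (n / d) := by
  obtain ⟨e, rfl⟩ := hdvd
  have hdZ : (d : ℤ) ≠ 0 := by exact_mod_cast hdpos.ne'
  rw [Nat.mul_div_cancel_left e hdpos] at h4 ⊢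
  rw [Nat.cast_mul, Int.mul_ediv_cancel_left _ hdZ] at h2
  have h2n : jacobiSym 2 d * jacobiSym 2 e = 1 := by
    have : NeZero d := ⟨hdpos.ne'⟩
    have : NeZero e := ⟨(Nat.pos_of_mul_pos_left hpos).ne'⟩
    rw [← jacobiSym.mul_right, jacobiSym_two_eq_one hn8]
  have h2de : jacobiSym 2 d = jacobiSym 2 e := by
    rcases Int.mul_eq_one_iff_eq_one_or_neg_one.1 h2n with h | h <;> rw [h.1, h.2]
  simp only [jacobiBr, jacobiSym_swap hn8 hsf h1 h2 h3 h4, h2de]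

end
end

section
/- Let p be an odd prime and let τ, μ, d be integers with μ ≠ 0, 2d = τ² + μ², and p ∤ 2d. If s ∈ ℤ_p satisfies s² = 2d, then the p-adic valuation v_p(s − τ) is even. -/
noncomputable section

/-- A `p`-adic integer of nonzero valuation is divisible by `p`. -/
theorem PadicInt.dvd_of_valuation_ne_zero {p : ℕ} [Fact p.Prime] {x : ℤ_[p]}
    (h : x.valuation ≠ 0) : (p : ℤ_[p]) ∣ x := by
  have hx : x ≠ 0 := by
    rintro rfl
    simp at h
  have := (PadicInt.mem_span_pow_iff_le_valuation x hx 1).2 (Nat.one_le_iff_ne_zero.2 h)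
  simpa [Ideal.mem_span_singleton] using this

/-- If `p` is an odd prime, `2d = τ² + μ²` with `μ ≠ 0` and `p ∤ 2d`, and `s ∈ ℤ_p` satisfies
`s² = 2d`, then the `p`-adic valuation of `s - τ` is even. -/
theorem even_valuation_sub
    (p : ℕ) [Fact p.Prime] (hp2 : p ≠ 2) (τ μ d : ℤ) (hμ : μ ≠ 0)
    (h2d : 2 * d = τ ^ 2 + μ ^ 2) (hpd : ¬(p : ℤ) ∣ 2 * d)
    (s : ℤ_[p]) (hs : s ^ 2 = ((2 * d : ℤ) : ℤ_[p])) :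
    Even ((s - (τ : ℤ_[p])).valuation) := by
  have hdvd (k : ℤ) : (p : ℤ_[p]) ∣ k ↔ (p : ℤ) ∣ k := by
    simpa using PadicInt.pow_p_dvd_int_iff (p := p) 1 k
  have hprod : (s - τ) * (s + τ) = (μ : ℤ_[p]) ^ 2 := by
    rw [h2d] at hs
    push_cast at hs
    linear_combination hs
  have hμ' : (μ : ℤ_[p]) ^ 2 ≠ 0 := pow_ne_zero 2 (by exact_mod_cast hμ)
  have hne := hprod ▸ hμ'
  have hval := congrArg PadicInt.valuation hprod
  rw [PadicInt.valuation_mul (left_ne_zero_of_mul hne) (right_ne_zero_of_mul hne),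
    PadicInt.valuation_pow] at hval
  by_cases h₁ : (s - (τ : ℤ_[p])).valuation = 0
  · simp [h₁]
  by_cases h₂ : (s + (τ : ℤ_[p])).valuation = 0
  · rw [h₂, add_zero] at hval
    exact hval ▸ even_two_mul _
  have h2s : (p : ℤ_[p]) ∣ 2 * s := by
    convert dvd_add (PadicInt.dvd_of_valuation_ne_zero h₁)
      (PadicInt.dvd_of_valuation_ne_zero h₂) using 1
    ring
  have hp : p.Prime := Fact.out
  refine absurd ?_ hpd
  rw [← hdvd, ← hs]
  refine dvd_pow ((PadicInt.prime_p.dvd_or_dvd h2s).resolve_left fun h ↦ hp2 ?_) two_ne_zero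
  have h' := (hdvd 2).1 (by exact_mod_cast h)
  exact (Nat.prime_dvd_prime_iff_eq hp Nat.prime_two).1 (by exact_mod_cast h')

end
end
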